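/- Let **A** ∈ ℝ^{Nn×Nn}_s be rank-one positive with ellipticity constant ν(**A**), satisfying the structural hypothesis (SH), and let Ω ⊆ ℝⁿ be open, convex and bounded (with C² boundary). Then for every map u : Ω → ℝ^N in (H² ∩ H¹₀)(Ω)^N one has the generalised Miranda–Talenti inequality ‖D²u‖_{L²(Ω)} ≤ (1/ν(**A**)) ‖**A**:D²u‖_{L²(Ω)}. -/

import Mathlib

open MeasureTheory Filter Topology
open scoped BigOperators

noncomputable section

/-- `Euc n` is the Euclidean space `ℝⁿ`. -/
abbrev Euc (n : ℕ) : Type := EuclideanSpace ℝ (Fin n)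

/-- Squared Euclidean norm of a finite vector. -/
def vsq {m : ℕ} (v : Fin m → ℝ) : ℝ := ∑ i, (v i) ^ 2

/-- Squared Euclidean norm of a third order tensor `X ∈ ℝ^{N×n×n}`. -/
def tsq {N n : ℕ} (X : Fin N → Fin n → Fin n → ℝ) : ℝ :=
  ∑ α, ∑ i, ∑ j, (X α i j) ^ 2

/-- First partial derivative `D_i f`. -/
def pder {n : ℕ} (f : Euc n → ℝ) (i : Fin n) (x : Euc n) : ℝ :=
  fderiv ℝ f x (EuclideanSpace.single i 1)

/-- Second partial derivative `D²_{ij} f`. -/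
def pder2 {n : ℕ} (f : Euc n → ℝ) (i j : Fin n) (x : Euc n) : ℝ :=
  pder (fun y => pder f j y) i x

/-- Hessian tensor `D²u(x) ∈ ℝ^{Nn²}` of a vector valued map `u : ℝⁿ → ℝ^N`. -/
def Hess {n N : ℕ} (u : Euc n → Fin N → ℝ) (x : Euc n) : Fin N → Fin n → Fin n → ℝ :=
  fun α i j => pder2 (fun y => u y α) i j x

/-- The contraction `(𝐀:X)_α = Σ_{i,β,j} A_{αiβj} X_{βij}`. -/
def AC {n N : ℕ} (A : Fin N → Fin n → Fin N → Fin n → ℝ)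
    (X : Fin N → Fin n → Fin n → ℝ) : Fin N → ℝ :=
  fun α => ∑ i, ∑ β, ∑ j, A α i β j * X β i j

/-- The quadratic form `𝐀 : η⊗a⊗η⊗a = Σ A_{αiβj} η_α a_i η_β a_j`. -/
def QF {n N : ℕ} (A : Fin N → Fin n → Fin N → Fin n → ℝ)
    (η : Fin N → ℝ) (a : Fin n → ℝ) : ℝ :=
  ∑ α, ∑ i, ∑ β, ∑ j, A α i β j * η α * a i * η β * a j

/-- Symmetry `A_{αiβj} = A_{βjαi}` of a fourth order tensor (i.e. `𝐀 ∈ ℝ^{Nn×Nn}_s`). -/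
def SymT {n N : ℕ} (A : Fin N → Fin n → Fin N → Fin n → ℝ) : Prop :=
  ∀ α i β j, A α i β j = A β j α i

/-- Symmetry `X_{αij} = X_{αji}`, i.e. `X ∈ ℝ^{Nn²}_s`. -/
def SymX {n N : ℕ} (X : Fin N → Fin n → Fin n → ℝ) : Prop :=
  ∀ α i j, X α i j = X α j i

/-- `𝐀` is rank-one positive: `𝐀:η⊗a⊗η⊗a ≥ ν |η|²|a|²` for some `ν > 0`. -/
def RankOnePos {n N : ℕ} (A : Fin N → Fin n → Fin N → Fin n → ℝ) : Prop :=
  ∃ ν > (0:ℝ), ∀ (η : Fin N → ℝ) (a : Fin n → ℝ), ν * vsq η * vsq a ≤ QF A η a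

/-- The ellipticity constant `ν(𝐀) = min_{|η|=|a|=1} 𝐀:η⊗a⊗η⊗a`. -/
def nuA {n N : ℕ} (A : Fin N → Fin n → Fin N → Fin n → ℝ) : ℝ :=
  sInf {v | ∃ (η : Fin N → ℝ) (a : Fin n → ℝ), vsq η = 1 ∧ vsq a = 1 ∧ v = QF A η a}

/-- The smallest eigenvalue `λ₁(M) = min_{|a|=1} M:a⊗a` of a symmetric matrix. -/
def lam1 {m : ℕ} (M : Matrix (Fin m) (Fin m) ℝ) : ℝ :=
  sInf {v | ∃ a : Fin m → ℝ, vsq a = 1 ∧ v = ∑ i, ∑ j, M i j * a i * a j}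

/-- The structural hypothesis (SH) for `𝐀` with the decomposition data
`𝐀 = Σ_γ B^γ ⊗ A^γ` given explicitly. -/
def SHdata {n N : ℕ} (A : Fin N → Fin n → Fin N → Fin n → ℝ)
    (B : Fin N → Matrix (Fin N) (Fin N) ℝ)
    (M : Fin N → Matrix (Fin n) (Fin n) ℝ) : Prop :=
  (∀ γ, (B γ).IsSymm) ∧ (∀ γ, (M γ).IsSymm) ∧
  (∀ α i β j, A α i β j = ∑ γ, B γ α β * M γ i j) ∧
  (∀ γ δ, γ ≠ δ → ∀ y z : Fin N → ℝ, ∑ α, (B γ).mulVec y α * (B δ).mulVec z α = 0) ∧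
  (∑ γ, B γ).PosDef ∧ (∀ γ, (M γ).PosDef) ∧
  (∃ a : Fin n → ℝ, a ≠ 0 ∧ ∀ γ, (M γ).mulVec a = lam1 (M γ) • a)

/-- The structural hypothesis (SH). -/
def SH {n N : ℕ} (A : Fin N → Fin n → Fin N → Fin n → ℝ) : Prop :=
  ∃ B M, SHdata A B M

/-- `Ω` is a (bounded) domain with `C²` boundary, encoded via a `C²` defining function
with nonvanishing gradient on the boundary. -/
def IsC2Domain {n : ℕ} (Ω : Set (Euc n)) : Prop :=
  ∃ ρ : Euc n → ℝ, ContDiff ℝ 2 ρ ∧ Ω = {x | ρ x < 0} ∧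
    ∀ x ∈ frontier Ω, fderiv ℝ ρ x ≠ 0

/-- `F : Ω × ℝ^{Nn²}_s → ℝ^N` is a Carathéodory map: measurable in `x`, continuous in `X`. -/
def Caratheodory {n N : ℕ} (Ω : Set (Euc n))
    (F : Euc n → (Fin N → Fin n → Fin n → ℝ) → Fin N → ℝ) : Prop :=
  (∀ X, Measurable fun x => F x X) ∧
  (∀ᵐ x ∂(volume.restrict Ω), Continuous fun X => F x X)

/-- The K-condition (ellipticity) for `F` with data `(𝐀, α, β, γ)`. -/
def KCond {n N : ℕ} (Ω : Set (Euc n))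
    (F : Euc n → (Fin N → Fin n → Fin n → ℝ) → Fin N → ℝ)
    (A : Fin N → Fin n → Fin N → Fin n → ℝ)
    (al : Euc n → ℝ) (β γ : ℝ) : Prop :=
  SymT A ∧ RankOnePos A ∧ Measurable al ∧
  (∃ C : ℝ, ∀ᵐ x ∂(volume.restrict Ω), |al x| ≤ C) ∧
  (∀ᵐ x ∂(volume.restrict Ω), 0 < al x) ∧
  (∃ C : ℝ, ∀ᵐ x ∂(volume.restrict Ω), |1 / al x| ≤ C) ∧
  0 < β ∧ 0 < γ ∧ β + γ < 1 ∧
  (∀ᵐ x ∂(volume.restrict Ω), ∀ X Z : Fin N → Fin n → Fin n → ℝ, SymX X → SymX Z →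
    Real.sqrt (vsq fun α => AC A Z α - al x * (F x (X + Z) α - F x X α)) ≤
      β * nuA A * Real.sqrt (tsq Z) + γ * Real.sqrt (vsq (AC A Z)))

/-- Membership `u ∈ (H² ∩ H¹₀)(Ω)^N` (as a strong/classical object): twice
differentiable on `Ω`, with `u`, `Du`, `D²u` square integrable on `Ω`, and zero
boundary trace. -/
structure IsH2H10 {n N : ℕ} (Ω : Set (Euc n)) (u : Euc n → Fin N → ℝ) : Prop where
  contDiffOn : ∀ α, ContDiffOn ℝ 2 (fun x => u x α) Ω
  memL2 : IntegrableOn (fun x => vsq (u x)) Ω volume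
  grad_memL2 : IntegrableOn (fun x => ∑ α, ∑ i, (pder (fun y => u y α) i x) ^ 2) Ω volume
  hess_memL2 : IntegrableOn (fun x => tsq (Hess u x)) Ω volume
  zero_trace : ∀ x ∈ frontier Ω, Tendsto u (nhdsWithin x Ω) (nhds 0)

/-- The `L²(Ω)^N` norm of a vector valued map. -/
def L2V {n N : ℕ} (Ω : Set (Euc n)) (g : Euc n → Fin N → ℝ) : ℝ :=
  Real.sqrt (∫ x in Ω, vsq (g x))

/-- The `L²(Ω)` norm of a tensor valued map. -/
def L2T {n N : ℕ} (Ω : Set (Euc n)) (G : Euc n → Fin N → Fin n → Fin n → ℝ) : ℝ :=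
  Real.sqrt (∫ x in Ω, tsq (G x))

/-- The `H²(Ω)^N` norm `‖u‖_{L²} + ‖Du‖_{L²} + ‖D²u‖_{L²}`. -/
def H2norm {n N : ℕ} (Ω : Set (Euc n)) (u : Euc n → Fin N → ℝ) : ℝ :=
  L2V Ω u + Real.sqrt (∫ x in Ω, ∑ α, ∑ i, (pder (fun y => u y α) i x) ^ 2) +
    L2T Ω (fun x => Hess u x)

end


theorem mt_ibp {n : ℕ} (F : Euc n → ℝ) (hF : ContDiff ℝ 1 F) (hc : HasCompactSupport F)
    (v : Euc n) : ∫ x, fderiv ℝ F x v = 0 := by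
  have hcont : Continuous (fun x => fderiv ℝ F x v) :=
    (hF.continuous_fderiv one_ne_zero).clm_apply continuous_const
  have hcs : HasCompactSupport (fun x => fderiv ℝ F x v) := hc.fderiv_apply (𝕜 := ℝ) v
  have h := integral_mul_fderiv_eq_neg_fderiv_mul_of_integrable (μ := (volume : Measure (Euc n)))
    (f := fun _ => (1:ℝ)) (g := F) (v := v)
    (by simp) (by simpa using hcont.integrable_of_hasCompactSupport hcs)
    (by simpa using hF.continuous.integrable_of_hasCompactSupport hc)
    (fun x _ => by fun_prop) (fun x _ => (hF.differentiable one_ne_zero) x)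
  simpa using h

theorem mt_fderiv_apply_contDiff {n : ℕ} {f : Euc n → ℝ} (hf : ContDiff ℝ 2 f) (v : Euc n) :
    ContDiff ℝ 1 (fun x => fderiv ℝ f x v) :=
  (hf.fderiv_right (m := 1) (by norm_num)).clm_apply contDiff_const

theorem mt_symm {n : ℕ} {f : Euc n → ℝ} {x : Euc n} (hf : ContDiffAt ℝ 2 f x) (v w : Euc n) :
    fderiv ℝ (fun y => fderiv ℝ f y v) x w = fderiv ℝ (fun y => fderiv ℝ f y w) x v := by
  have hd : DifferentiableAt ℝ (fderiv ℝ f) x :=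
    (hf.fderiv_right (m := 1) (by norm_num)).differentiableAt one_ne_zero
  have hs : IsSymmSndFDerivAt ℝ f x := hf.isSymmSndFDerivAt (by simp)
  have e : ∀ v w : Euc n, fderiv ℝ (fun y => fderiv ℝ f y v) x w
      = fderiv ℝ (fderiv ℝ f) x w v := by
    intro v w
    rw [fderiv_clm_apply hd (differentiableAt_const v)]
    simp
  rw [e, e]
  exact hs.eq w v

theorem mt_moll {n : ℕ} (q : Euc n → ℝ) (hq : ContDiff ℝ 1 q) (hc : HasCompactSupport q) :
    ∃ Q : ℕ → Euc n → ℝ, (∀ j, ContDiff ℝ 2 (Q j)) ∧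
      ∀ v, (∃ C, ∀ j x, |fderiv ℝ (Q j) x v| ≤ C) ∧
        ∀ x, Tendsto (fun j => fderiv ℝ (Q j) x v) atTop (𝓝 (fderiv ℝ q x v)) := by
  let ρ : ℕ → ContDiffBump (0 : Euc n) := fun j =>
    ⟨1 / (2 * ((j:ℝ) + 1)), 1 / ((j:ℝ) + 1), by positivity, by
      apply one_div_lt_one_div_of_lt <;> linarith [show (0:ℝ) < (j:ℝ) + 1 by positivity]⟩
  have hr : Tendsto (fun j => (ρ j).rOut) atTop (𝓝 0) := tendsto_one_div_add_atTop_nhds_zero_nat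
  let Q : ℕ → Euc n → ℝ := fun j =>
    convolution ((ρ j).normed volume) q (ContinuousLinearMap.lsmul ℝ ℝ) volume
  have hli : LocallyIntegrable q volume := hq.continuous.locallyIntegrable
  have hfd : ∀ j x v, fderiv ℝ (Q j) x v =
      convolution ((ρ j).normed volume) (fun y => fderiv ℝ q y v)
        (ContinuousLinearMap.lsmul ℝ ℝ) volume x := by
    intro j x v
    have hli2 : LocallyIntegrable ((ρ j).normed (volume : Measure (Euc n))) volume :=
      (ρ j).continuous_normed.locallyIntegrable
    rw [(hc.hasFDerivAt_convolution_right (ContinuousLinearMap.lsmul ℝ ℝ) hli2 hq x).fderiv]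
    exact convolution_precompR_apply _ hli2 (hc.fderiv ℝ) (hq.continuous_fderiv one_ne_zero) _ _
  refine ⟨Q, fun j => ?_, fun v => ⟨?_, fun x => ?_⟩⟩
  · exact ((ρ j).hasCompactSupport_normed).contDiff_convolution_left (n := 2) _
      ((ρ j).contDiff_normed) hli
  · have hcont : Continuous (fun x => fderiv ℝ q x v) :=
      (hq.continuous_fderiv one_ne_zero).clm_apply continuous_const
    obtain ⟨C, hC⟩ := (hc.fderiv_apply (𝕜 := ℝ) v).exists_bound_of_continuous hcont
    refine ⟨3 * C, fun j x => ?_⟩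
    have := ContDiffBump.dist_normed_convolution_le (φ := ρ j) (x₀ := x) (ε := 2 * C)
      (g := fun x => fderiv ℝ q x v) (μ := volume) hcont.aestronglyMeasurable (by
        intro y _
        rw [Real.dist_eq]
        have h1 := hC x
        have h2 := hC y
        rw [Real.norm_eq_abs, abs_le] at h1 h2
        rw [abs_le]; constructor <;> linarith)
    rw [hfd]
    rw [Real.dist_eq, abs_le] at this
    have h1 := hC x
    rw [Real.norm_eq_abs, abs_le] at h1
    rw [abs_le]; constructor <;> linarith
  · simp_rw [hfd]
    exact ContDiffBump.convolution_tendsto_right_of_continuous hr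
      ((hq.continuous_fderiv one_ne_zero).clm_apply continuous_const) x

theorem mt_jac0 {n : ℕ} (ψ p q : Euc n → ℝ) (hψ : ContDiff ℝ 1 ψ) (hψc : HasCompactSupport ψ)
    (hp : ContDiff ℝ 1 p) (hq : ContDiff ℝ 2 q) (a b : Euc n) :
    ∫ x, (ψ x * (fderiv ℝ p x a * fderiv ℝ q x b - fderiv ℝ p x b * fderiv ℝ q x a)
      + p x * (fderiv ℝ ψ x a * fderiv ℝ q x b - fderiv ℝ ψ x b * fderiv ℝ q x a)) = 0 := by
  have key : ∀ a b : Euc n, ContDiff ℝ 1 (fun x => ψ x * (p x * fderiv ℝ q x b)) := fun a b =>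
    hψ.mul (hp.mul (mt_fderiv_apply_contDiff hq b))
  have hcs : ∀ b : Euc n, HasCompactSupport (fun x => ψ x * (p x * fderiv ℝ q x b)) := fun b =>
    hψc.mul_right
  have hint : ∀ a b : Euc n,
      Integrable (fun x => fderiv ℝ (fun x => ψ x * (p x * fderiv ℝ q x b)) x a) := fun a b =>
    (((key a b).continuous_fderiv one_ne_zero).clm_apply
      continuous_const).integrable_of_hasCompactSupport ((hcs b).fderiv_apply (𝕜 := ℝ) a)
  have h1 := mt_ibp _ (key a b) (hcs b) a
  have h2 := mt_ibp _ (key b a) (hcs a) b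
  have h3 := integral_sub (hint a b) (hint b a)
  rw [h1, h2, sub_zero] at h3
  rw [← h3]
  congr 1
  ext x
  have hψd : DifferentiableAt ℝ ψ x := hψ.differentiable one_ne_zero x
  have hpd : DifferentiableAt ℝ p x := hp.differentiable one_ne_zero x
  have hqd : ∀ b, DifferentiableAt ℝ (fun x => fderiv ℝ q x b) x := fun b =>
    (mt_fderiv_apply_contDiff hq b).differentiable one_ne_zero x
  have e : ∀ a b, fderiv ℝ (fun x => ψ x * (p x * fderiv ℝ q x b)) x a =
      fderiv ℝ ψ x a * (p x * fderiv ℝ q x b) + ψ x * (fderiv ℝ p x a * fderiv ℝ q x b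
        + p x * fderiv ℝ (fun y => fderiv ℝ q y b) x a) := by
    intro a b
    rw [fderiv_fun_mul hψd (hpd.fun_mul (hqd b)), fderiv_fun_mul hpd (hqd b)]
    simp
    ring
  rw [e, e, mt_symm hq.contDiffAt a b]
  ring

theorem mt_jac {n : ℕ} (ψ p q : Euc n → ℝ) (hψ : ContDiff ℝ 1 ψ) (hψc : HasCompactSupport ψ)
    (hp : ContDiff ℝ 1 p) (hq : ContDiff ℝ 1 q) (hqc : HasCompactSupport q) (a b : Euc n) :
    ∫ x, (ψ x * (fderiv ℝ p x a * fderiv ℝ q x b - fderiv ℝ p x b * fderiv ℝ q x a)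
      + p x * (fderiv ℝ ψ x a * fderiv ℝ q x b - fderiv ℝ ψ x b * fderiv ℝ q x a)) = 0 := by
  obtain ⟨Q, hQ, hQ2⟩ := mt_moll q hq hqc
  obtain ⟨⟨Ca, hCa⟩, hta⟩ := hQ2 a
  obtain ⟨⟨Cb, hCb⟩, htb⟩ := hQ2 b
  let P1 : Euc n → ℝ := fun x => ψ x * fderiv ℝ p x a + fderiv ℝ ψ x a * p x
  let P2 : Euc n → ℝ := fun x => ψ x * fderiv ℝ p x b + fderiv ℝ ψ x b * p x
  have hcf : ∀ {f : Euc n → ℝ} (_ : ContDiff ℝ 1 f) (v : Euc n),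
      Continuous (fun x => fderiv ℝ f x v) := fun hf v =>
    (hf.continuous_fderiv one_ne_zero).clm_apply continuous_const
  have hP : ∀ a : Euc n, Integrable (fun x => ψ x * fderiv ℝ p x a + fderiv ℝ ψ x a * p x) := by
    intro a
    refine Continuous.integrable_of_hasCompactSupport ?_ ?_
    · exact (hψ.continuous.mul (hcf hp a)).add ((hcf hψ a).mul hp.continuous)
    · exact (hψc.mul_right).add ((hψc.fderiv_apply (𝕜 := ℝ) a).mul_right)
  have hlim := tendsto_integral_of_dominated_convergence (μ := (volume : Measure (Euc n)))
    (F := fun j x => (ψ x * (fderiv ℝ p x a * fderiv ℝ (Q j) x b - fderiv ℝ p x b * fderiv ℝ (Q j) x a)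
      + p x * (fderiv ℝ ψ x a * fderiv ℝ (Q j) x b - fderiv ℝ ψ x b * fderiv ℝ (Q j) x a)))
    (f := fun x => (ψ x * (fderiv ℝ p x a * fderiv ℝ q x b - fderiv ℝ p x b * fderiv ℝ q x a)
      + p x * (fderiv ℝ ψ x a * fderiv ℝ q x b - fderiv ℝ ψ x b * fderiv ℝ q x a)))
    (fun x => |P1 x| * Cb + |P2 x| * Ca) ?_ ?_ ?_ ?_
  · have hz : ∀ j, ∫ x, (ψ x * (fderiv ℝ p x a * fderiv ℝ (Q j) x b - fderiv ℝ p x b * fderiv ℝ (Q j) x a)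
      + p x * (fderiv ℝ ψ x a * fderiv ℝ (Q j) x b - fderiv ℝ ψ x b * fderiv ℝ (Q j) x a)) = 0 :=
      fun j => mt_jac0 ψ p (Q j) hψ hψc hp (hQ j) a b
    simp_rw [hz] at hlim
    exact (tendsto_nhds_unique hlim tendsto_const_nhds)
  · intro j
    have h1 : ContDiff ℝ 1 (Q j) := (hQ j).of_le (by norm_num)
    have := hcf h1 a
    have := hcf h1 b
    have := hcf hp a
    have := hcf hp b
    have := hcf hψ a
    have := hcf hψ b
    have := hψ.continuous
    have := hp.continuous
    exact Continuous.aestronglyMeasurable (by fun_prop)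
  · exact ((hP a).abs.mul_const _).add ((hP b).abs.mul_const _)
  · intro j
    refine Eventually.of_forall fun x => ?_
    have : (ψ x * (fderiv ℝ p x a * fderiv ℝ (Q j) x b - fderiv ℝ p x b * fderiv ℝ (Q j) x a)
      + p x * (fderiv ℝ ψ x a * fderiv ℝ (Q j) x b - fderiv ℝ ψ x b * fderiv ℝ (Q j) x a))
      = P1 x * fderiv ℝ (Q j) x b - P2 x * fderiv ℝ (Q j) x a := by
      simp only [P1, P2]; ring
    rw [this, Real.norm_eq_abs]
    refine (abs_sub _ _).trans ?_
    rw [abs_mul, abs_mul]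
    gcongr
    · exact hCb j x
    · exact hCa j x
  · refine Eventually.of_forall fun x => ?_
    exact (((tendsto_const_nhds.mul (htb x)).sub (tendsto_const_nhds.mul (hta x))).const_mul _).add
      (((tendsto_const_nhds.mul (htb x)).sub (tendsto_const_nhds.mul (hta x))).const_mul _)


/-- directional first derivative -/
noncomputable def mtD {n : ℕ} (f : Euc n → ℝ) (v x : Euc n) : ℝ := fderiv ℝ f x v

/-- directional second derivative -/
noncomputable def mtH {n : ℕ} (f : Euc n → ℝ) (v w x : Euc n) : ℝ := fderiv ℝ (fun y => fderiv ℝ f y w) x v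

/-- the second symmetric function of the Hessian along a family of vectors -/
noncomputable def mtJ {n : ℕ} {ι : Type} [Fintype ι] (c : ι → Euc n) (f : Euc n → ℝ) (x : Euc n) : ℝ :=
  ∑ m, ∑ l, (mtH f (c m) (c m) x * mtH f (c l) (c l) x - mtH f (c m) (c l) x ^ 2)

/-- the associated vector field -/
noncomputable def mtV {n : ℕ} {ι : Type} [Fintype ι] (c : ι → Euc n) (f : Euc n → ℝ) (m : ι) (x : Euc n) : ℝ :=
  ∑ l, (mtD f (c m) x * mtH f (c l) (c l) x - mtD f (c l) x * mtH f (c m) (c l) x)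

theorem mtD_congr {n : ℕ} {f g : Euc n → ℝ} {x : Euc n} (h : f =ᶠ[𝓝 x] g) (v : Euc n) :
    mtD f v x = mtD g v x := by
  unfold mtD; rw [h.fderiv_eq]

theorem mtH_congr {n : ℕ} {f g : Euc n → ℝ} {x : Euc n} (h : f =ᶠ[𝓝 x] g) (v w : Euc n) :
    mtH f v w x = mtH g v w x := by
  unfold mtH
  have : (fun y => fderiv ℝ f y w) =ᶠ[𝓝 x] (fun y => fderiv ℝ g y w) := by
    filter_upwards [h.fderiv (𝕜 := ℝ)] with y hy
    rw [hy]
  rw [this.fderiv_eq]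

theorem mt_ext {n : ℕ} {Ω K : Set (Euc n)} (hΩ : IsOpen Ω) (hK : IsCompact K) (hKΩ : K ⊆ Ω)
    {u : Euc n → ℝ} (hu : ContDiffOn ℝ 2 u Ω) :
    ∃ v : Euc n → ℝ, ContDiff ℝ 2 v ∧ HasCompactSupport v ∧ ∀ x ∈ K, u =ᶠ[𝓝 x] v := by
  obtain ⟨L, hL, hKL, hLΩ⟩ := exists_compact_between hK hΩ hKΩ
  obtain ⟨χ, h1, h0, -⟩ := exists_contMDiffMap_one_nhds_of_subset_interior
    (modelWithCornersSelf ℝ (Euc n)) (n := 2) hK.isClosed hKL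
  have hχ : ContDiff ℝ 2 χ := χ.contMDiff.contDiff
  refine ⟨fun x => χ x * u x, ?_, ?_, ?_⟩
  · rw [contDiff_iff_contDiffAt]
    intro x
    by_cases hx : x ∈ Ω
    · exact hχ.contDiffAt.mul (hu.contDiffAt (hΩ.mem_nhds hx))
    · have hxL : x ∈ Lᶜ := fun h => hx (hLΩ h)
      have : (fun x => χ x * u x) =ᶠ[𝓝 x] fun _ => 0 := by
        filter_upwards [hL.isClosed.isOpen_compl.mem_nhds hxL] with y hy
        rw [h0 y hy, zero_mul]
      exact contDiffAt_const.congr_of_eventuallyEq this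
  · refine HasCompactSupport.intro hL fun x hx => ?_
    simp only [h0 x hx, zero_mul]
  · intro x hx
    have := (eventually_nhdsSet_iff_forall.1 h1) x hx
    filter_upwards [this] with y hy
    rw [hy, one_mul]

theorem mt_L1 {n : ℕ} {ι : Type} [Fintype ι] (c : ι → Euc n) (ψ u : Euc n → ℝ)
    (hψ : ContDiff ℝ 1 ψ) (hψc : HasCompactSupport ψ) (hu : ContDiff ℝ 2 u)
    (huc : HasCompactSupport u) :
    ∫ x, (ψ x * mtJ c u x + ∑ m, mtD ψ (c m) x * mtV c u m x) = 0 := by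
  have hcf : ∀ {f : Euc n → ℝ} (_ : ContDiff ℝ 1 f) (v : Euc n),
      Continuous (fun x => fderiv ℝ f x v) := fun hf v =>
    (hf.continuous_fderiv one_ne_zero).clm_apply continuous_const
  have key : ∀ m l, Integrable (fun x => (ψ x * (mtH u (c m) (c m) x * mtH u (c l) (c l) x
      - mtH u (c l) (c m) x * mtH u (c m) (c l) x)
      + mtD u (c m) x * (mtD ψ (c m) x * mtH u (c l) (c l) x - mtD ψ (c l) x * mtH u (c m) (c l) x)))
      := by
    intro m l
    refine Continuous.integrable_of_hasCompactSupport ?_ ?_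
    · have h1 := hcf (mt_fderiv_apply_contDiff hu (c m)) (c m)
      have h2 := hcf (mt_fderiv_apply_contDiff hu (c l)) (c l)
      have h3 := hcf (mt_fderiv_apply_contDiff hu (c m)) (c l)
      have h4 := hcf (mt_fderiv_apply_contDiff hu (c l)) (c m)
      have h5 := hcf hψ (c l)
      have h6 := hcf hψ (c m)
      have h7 := (mt_fderiv_apply_contDiff hu (c m)).continuous
      have h8 := hψ.continuous
      unfold mtH mtD
      fun_prop
    · refine HasCompactSupport.add hψc.mul_right (HasCompactSupport.mul_left ?_)
      exact ((hψc.fderiv_apply (𝕜 := ℝ) (c m)).mul_right).sub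
        ((hψc.fderiv_apply (𝕜 := ℝ) (c l)).mul_right)
  have h0 : ∀ m l, ∫ x, (ψ x * (mtH u (c m) (c m) x * mtH u (c l) (c l) x
      - mtH u (c l) (c m) x * mtH u (c m) (c l) x)
      + mtD u (c m) x * (mtD ψ (c m) x * mtH u (c l) (c l) x - mtD ψ (c l) x * mtH u (c m) (c l) x))
      = 0 := fun m l =>
    mt_jac ψ _ _ hψ hψc (mt_fderiv_apply_contDiff hu (c m)) (mt_fderiv_apply_contDiff hu (c l))
      (huc.fderiv_apply (𝕜 := ℝ) (c l)) (c m) (c l)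
  have hs : ∫ x, ∑ m, ∑ l, (ψ x * (mtH u (c m) (c m) x * mtH u (c l) (c l) x
      - mtH u (c l) (c m) x * mtH u (c m) (c l) x)
      + mtD u (c m) x * (mtD ψ (c m) x * mtH u (c l) (c l) x - mtD ψ (c l) x * mtH u (c m) (c l) x))
      = 0 := by
    rw [integral_finsetSum _ (fun m _ => integrable_finsetSum _ fun l _ => key m l)]
    refine Finset.sum_eq_zero fun m _ => ?_
    rw [integral_finsetSum _ (fun l _ => key m l)]
    exact Finset.sum_eq_zero fun l _ => h0 m l
  rw [← hs]
  congr 1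
  ext x
  have hsy : ∀ m l, mtH u (c l) (c m) x = mtH u (c m) (c l) x := fun m l =>
    mt_symm hu.contDiffAt (c m) (c l)
  have hsw : ∑ m, ∑ l, mtD ψ (c m) x * (mtD u (c l) x * mtH u (c m) (c l) x) =
      ∑ m, ∑ l, mtD ψ (c l) x * (mtD u (c m) x * mtH u (c m) (c l) x) := by
    rw [Finset.sum_comm]
    refine Finset.sum_congr rfl fun m _ => Finset.sum_congr rfl fun l _ => ?_
    rw [hsy]
  unfold mtJ mtV
  simp only [Finset.mul_sum, mul_sub, Finset.sum_sub_distrib, Finset.sum_add_distrib] at hsw ⊢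
  rw [hsw]
  have e1 : ∀ m l, ψ x * (mtH u (c l) (c m) x * mtH u (c m) (c l) x) =
     ψ x * mtH u (c m) (c l) x ^ 2 := by intro m l; rw [hsy]; ring
  have e2 : ∀ m l, mtD u (c m) x * (mtD ψ (c m) x * mtH u (c l) (c l) x) =
     mtD ψ (c m) x * (mtD u (c m) x * mtH u (c l) (c l) x) := by intro m l; ring
  have e3 : ∀ m l, mtD u (c m) x * (mtD ψ (c l) x * mtH u (c m) (c l) x) =
     mtD ψ (c l) x * (mtD u (c m) x * mtH u (c m) (c l) x) := by intro m l; ring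
  simp only [e1, e2, e3]

theorem mt_L1' {n : ℕ} {ι : Type} [Fintype ι] (c : ι → Euc n) {Ω : Set (Euc n)} (hΩ : IsOpen Ω)
    (ψ u : Euc n → ℝ)
    (hψ : ContDiff ℝ 1 ψ) (hψc : HasCompactSupport ψ) (hψΩ : tsupport ψ ⊆ Ω)
    (hu : ContDiffOn ℝ 2 u Ω) :
    ∫ x in Ω, (ψ x * mtJ c u x + ∑ m, mtD ψ (c m) x * mtV c u m x) = 0 := by
  have hz : ∀ (u : Euc n → ℝ), ∀ x ∉ tsupport ψ,
      (ψ x * mtJ c u x + ∑ m, mtD ψ (c m) x * mtV c u m x) = 0 := by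
    intro u x hx
    have h1 : ψ x = 0 := image_eq_zero_of_notMem_tsupport hx
    have h2 : fderiv ℝ ψ x = 0 := by
      by_contra h
      exact hx (support_fderiv_subset ℝ h)
    simp [mtD, h1, h2]
  rw [setIntegral_eq_integral_of_forall_compl_eq_zero (fun x hx => hz u x fun h => hx (hψΩ h))]
  obtain ⟨v, hv, hvc, huv⟩ := mt_ext hΩ hψc hψΩ hu
  rw [← mt_L1 c ψ v hψ hψc hv hvc]
  congr 1
  ext x
  by_cases hx : x ∈ tsupport ψ
  · have := huv x hx
    unfold mtJ mtV
    simp only [mtH_congr this, mtD_congr this]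
  · rw [hz u x hx, hz v x hx]

theorem mt_L2 {n : ℕ} {ι : Type} [Fintype ι] (c : ι → Euc n) (φ w u : Euc n → ℝ)
    (hφ : ContDiff ℝ 2 φ) (hw : ContDiff ℝ 2 w) (hwc : HasCompactSupport w)
    (hu : ContDiff ℝ 2 u) :
    ∫ x, ∑ m, ∑ l, (mtD φ (c m) x *
      (mtD w (c m) x * mtH u (c l) (c l) x - mtD w (c l) x * mtH u (c m) (c l) x)
      - (mtH φ (c m) (c m) x * (mtD w (c l) x * mtD u (c l) x)
        - mtH φ (c l) (c m) x * (mtD w (c m) x * mtD u (c l) x))) = 0 := by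
  have hC := fun {f : Euc n → ℝ} (hf : ContDiff ℝ 2 f) v => mt_fderiv_apply_contDiff hf v
  have hF : ∀ m l k, ContDiff ℝ 1 (fun x => fderiv ℝ w x (c l) * (fderiv ℝ φ x (c m) *
      fderiv ℝ u x (c k))) := fun m l k => (hC hw _).mul ((hC hφ _).mul (hC hu _))
  have hFc : ∀ m l k, HasCompactSupport (fun x => fderiv ℝ w x (c l) * (fderiv ℝ φ x (c m) *
      fderiv ℝ u x (c k))) := fun m l k => (hwc.fderiv_apply (𝕜 := ℝ) (c l)).mul_right
  have hI : ∀ m l k v, Integrable (fun x => fderiv ℝ (fun x => fderiv ℝ w x (c l) *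
      (fderiv ℝ φ x (c m) * fderiv ℝ u x (c k))) x v) := fun m l k v =>
    (((hF m l k).continuous_fderiv one_ne_zero).clm_apply
      continuous_const).integrable_of_hasCompactSupport ((hFc m l k).fderiv_apply (𝕜 := ℝ) v)
  have e : ∀ x m l k v, fderiv ℝ (fun x => fderiv ℝ w x (c l) *
      (fderiv ℝ φ x (c m) * fderiv ℝ u x (c k))) x v =
      mtH w v (c l) x * (mtD φ (c m) x * mtD u (c k) x) +
      mtD w (c l) x * (mtH φ v (c m) x * mtD u (c k) x + mtD φ (c m) x * mtH u v (c k) x) := by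
    intro x m l k v
    have d1 := (hC hw (c l)).differentiable one_ne_zero x
    have d2 := (hC hφ (c m)).differentiable one_ne_zero x
    have d3 := (hC hu (c k)).differentiable one_ne_zero x
    rw [fderiv_fun_mul d1 (d2.fun_mul d3), fderiv_fun_mul d2 d3]
    simp [mtH, mtD]
    ring
  have hI2 : ∀ m l, Integrable (fun x => fderiv ℝ (fun x => fderiv ℝ w x (c m) *
      (fderiv ℝ φ x (c m) * fderiv ℝ u x (c l))) x (c l) - fderiv ℝ (fun x => fderiv ℝ w x (c l) *
      (fderiv ℝ φ x (c m) * fderiv ℝ u x (c l))) x (c m)) := fun m l =>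
    (hI m m l (c l)).sub (hI m l l (c m))
  have hs : ∫ x, ∑ m, ∑ l, (fderiv ℝ (fun x => fderiv ℝ w x (c m) *
      (fderiv ℝ φ x (c m) * fderiv ℝ u x (c l))) x (c l) - fderiv ℝ (fun x => fderiv ℝ w x (c l) *
      (fderiv ℝ φ x (c m) * fderiv ℝ u x (c l))) x (c m)) = 0 := by
    rw [integral_finsetSum _ (fun m _ => integrable_finsetSum _ fun l _ =>
      hI2 m l)]
    refine Finset.sum_eq_zero fun m _ => ?_
    rw [integral_finsetSum _ (fun l _ => hI2 m l)]
    refine Finset.sum_eq_zero fun l _ => ?_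
    rw [integral_sub (hI m m l (c l)) (hI m l l (c m)), mt_ibp _ (hF m m l) (hFc m m l),
      mt_ibp _ (hF m l l) (hFc m l l), sub_zero]
  rw [← hs]
  congr 1
  ext x
  refine Finset.sum_congr rfl fun m _ => Finset.sum_congr rfl fun l _ => ?_
  rw [e, e]
  have : mtH w (c l) (c m) x = mtH w (c m) (c l) x := mt_symm hw.contDiffAt (c m) (c l)
  rw [this]
  ring

theorem mt_L2' {n : ℕ} {ι : Type} [Fintype ι] (c : ι → Euc n) {Ω : Set (Euc n)} (hΩ : IsOpen Ω)
    (φ w u : Euc n → ℝ)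
    (hφ : ContDiff ℝ 2 φ) (hw : ContDiff ℝ 2 w) (hwc : HasCompactSupport w)
    (hwΩ : tsupport w ⊆ Ω) (hu : ContDiffOn ℝ 2 u Ω) :
    ∫ x in Ω, ∑ m, ∑ l, (mtD φ (c m) x *
      (mtD w (c m) x * mtH u (c l) (c l) x - mtD w (c l) x * mtH u (c m) (c l) x)
      - (mtH φ (c m) (c m) x * (mtD w (c l) x * mtD u (c l) x)
        - mtH φ (c l) (c m) x * (mtD w (c m) x * mtD u (c l) x))) = 0 := by
  have hz : ∀ (u : Euc n → ℝ), ∀ x ∉ tsupport w, ∑ m, ∑ l, (mtD φ (c m) x *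
      (mtD w (c m) x * mtH u (c l) (c l) x - mtD w (c l) x * mtH u (c m) (c l) x)
      - (mtH φ (c m) (c m) x * (mtD w (c l) x * mtD u (c l) x)
        - mtH φ (c l) (c m) x * (mtD w (c m) x * mtD u (c l) x))) = 0 := by
    intro u x hx
    have h2 : fderiv ℝ w x = 0 := by
      by_contra h
      exact hx (support_fderiv_subset ℝ h)
    have h3 : ∀ v, mtD w v x = 0 := by intro v; simp [mtD, h2]
    simp [h3]
  rw [setIntegral_eq_integral_of_forall_compl_eq_zero (fun x hx => hz u x fun h => hx (hwΩ h))]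
  obtain ⟨v, hv, hvc, huv⟩ := mt_ext hΩ hwc hwΩ hu
  rw [← mt_L2 c φ w v hφ hw hwc hv]
  congr 1
  ext x
  by_cases hx : x ∈ tsupport w
  · have := huv x hx
    simp only [mtH_congr this, mtD_congr this]
  · rw [hz u x hx, hz v x hx]


open scoped MatrixOrder ComplexOrder in
theorem mt_factor {ι : Type} [Fintype ι] [DecidableEq ι] {G : Matrix ι ι ℝ} (hG : G.PosSemidef) :
    ∃ B : Matrix ι ι ℝ, G = B.conjTranspose * B :=
  CStarAlgebra.nonneg_iff_eq_star_mul_self.mp hG.nonneg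

theorem mt_smooth_convex {n : ℕ} {f : Euc n → ℝ} {K : NNReal} (hf : ConvexOn ℝ Set.univ f)
    (hL : LipschitzWith K f) {r : ℝ} (hr : 0 < r) :
    ∃ g : Euc n → ℝ, ContDiff ℝ 2 g ∧ ConvexOn ℝ Set.univ g ∧
      (∀ x v, |fderiv ℝ g x v| ≤ K * ‖v‖) ∧ ∀ x, |g x - f x| ≤ K * r := by
  let ρ : ContDiffBump (0 : Euc n) := ⟨r / 2, r, by positivity, by linarith⟩
  let g : Euc n → ℝ :=
    convolution (ρ.normed volume) f (ContinuousLinearMap.lsmul ℝ ℝ) volume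
  have hli : LocallyIntegrable f volume := hL.continuous.locallyIntegrable
  have hg : ContDiff ℝ 2 g :=
    (ρ.hasCompactSupport_normed).contDiff_convolution_left (n := 2) _ (ρ.contDiff_normed) hli
  have hgx : ∀ x, g x = ∫ t, ρ.normed volume t * f (x - t) := by
    intro x
    simp only [g, convolution_def, ContinuousLinearMap.lsmul_apply, smul_eq_mul]
  have hint : ∀ x, Integrable (fun t => ρ.normed volume t * f (x - t)) := by
    intro x
    refine Continuous.integrable_of_hasCompactSupport ?_ ?_
    · exact ρ.continuous_normed.mul (hL.continuous.comp (by fun_prop))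
    · exact (ρ.hasCompactSupport_normed).mul_right
  have hi0 : Integrable (fun t => ρ.normed (volume : Measure (Euc n)) t) :=
    ρ.continuous_normed.integrable_of_hasCompactSupport ρ.hasCompactSupport_normed
  have hgL : LipschitzWith K g := by
    refine LipschitzWith.of_dist_le_mul fun x y => ?_
    rw [Real.dist_eq, hgx, hgx, ← integral_sub (hint x) (hint y), ← Real.norm_eq_abs]
    have : (K:ℝ) * dist x y = ∫ t, ρ.normed (volume : Measure (Euc n)) t * (K * dist x y) := by
      rw [integral_mul_const, ρ.integral_normed, one_mul]
    rw [this]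
    refine norm_integral_le_of_norm_le (hi0.mul_const _) (Eventually.of_forall fun t => ?_)
    rw [← mul_sub, norm_mul, Real.norm_eq_abs, abs_of_nonneg (ρ.nonneg_normed t)]
    refine mul_le_mul_of_nonneg_left ?_ (ρ.nonneg_normed t)
    have := hL.dist_le_mul (x - t) (y - t)
    rwa [Real.dist_eq, dist_sub_right, ← Real.norm_eq_abs] at this
  refine ⟨g, hg, ⟨convex_univ, ?_⟩, ?_, ?_⟩
  · intro x _ y _ a b ha hb hab
    simp only [smul_eq_mul]
    rw [hgx, hgx, hgx, ← integral_const_mul, ← integral_const_mul,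
      ← integral_add ((hint x).const_mul a) ((hint y).const_mul b)]
    refine integral_mono (hint _) (((hint x).const_mul a).add ((hint y).const_mul b)) fun t => ?_
    have h := hf.2 (Set.mem_univ (x - t)) (Set.mem_univ (y - t)) ha hb hab
    have e : a • x + b • y - t = a • (x - t) + b • (y - t) := by
      have : t = (a + b) • t := by rw [hab, one_smul]
      conv_lhs => rw [this]
      rw [add_smul, smul_sub, smul_sub]; abel
    have hn := ρ.nonneg_normed (μ := (volume : Measure (Euc n))) t
    simp only [smul_eq_mul] at h
    simp only []
    rw [e]
    nlinarith [mul_le_mul_of_nonneg_left h hn]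
  · intro x v
    have h1 := norm_fderiv_le_of_lipschitz ℝ hgL (x₀ := x)
    have h2 := (fderiv ℝ g x).le_opNorm v
    rw [Real.norm_eq_abs] at h2
    exact h2.trans (mul_le_mul_of_nonneg_right h1 (norm_nonneg v))
  · intro x
    have := ContDiffBump.dist_normed_convolution_le (φ := ρ) (x₀ := x) (ε := K * r)
      (g := f) (μ := volume) hL.continuous.aestronglyMeasurable (by
        intro y hy
        refine (hL.dist_le_mul y x).trans ?_
        exact mul_le_mul_of_nonneg_left (Metric.mem_ball.1 hy).le K.2)
    rwa [Real.dist_eq] at this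

theorem mtH_eq {n : ℕ} {f : Euc n → ℝ} (hf : ContDiff ℝ 2 f) (v w x : Euc n) :
    mtH f v w x = fderiv ℝ (fderiv ℝ f) x v w := by
  have hd : DifferentiableAt ℝ (fderiv ℝ f) x :=
    (hf.fderiv_right (m := 1) (by norm_num)).differentiable one_ne_zero x
  unfold mtH
  rw [fderiv_clm_apply hd (differentiableAt_const w)]
  simp

theorem mtH_nonneg {n : ℕ} {g : Euc n → ℝ} (hg : ContDiff ℝ 2 g) (hc : ConvexOn ℝ Set.univ g)
    (v x : Euc n) : 0 ≤ mtH g v v x := by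
  have hl : ∀ t : ℝ, HasDerivAt (fun t : ℝ => x + t • v) v t := by
    intro t
    simpa using ((hasDerivAt_id t).smul_const v).const_add x
  have h1 : ∀ t : ℝ, HasDerivAt (fun t : ℝ => g (x + t • v)) (fderiv ℝ g (x + t • v) v) t := by
    intro t
    exact ((hg.differentiable two_ne_zero (x + t • v)).hasFDerivAt).comp_hasDerivAt t (hl t)
  have h2 : HasDerivAt (fun t : ℝ => fderiv ℝ g (x + t • v) v) (mtH g v v x) 0 := by
    have hd := (mt_fderiv_apply_contDiff hg v).differentiable one_ne_zero (x + (0:ℝ) • v)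
    have := hd.hasFDerivAt.comp_hasDerivAt (0:ℝ) (hl 0)
    rw [zero_smul, add_zero] at this
    exact this
  have hcv : ConvexOn ℝ Set.univ (fun t : ℝ => g (x + t • v)) := by
    refine ⟨convex_univ, ?_⟩
    intro s _ t _ a b ha hb hab
    have h := hc.2 (Set.mem_univ (x + s • v)) (Set.mem_univ (x + t • v)) ha hb hab
    have e : x + (a • s + b • t) • v = a • (x + s • v) + b • (x + t • v) := by
      have : x = (a + b) • x := by rw [hab, one_smul]
      conv_lhs => rw [this]
      simp only [smul_eq_mul, add_smul, smul_add, mul_smul]; abel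
    simp only []
    rw [e]
    exact h
  have hm : Monotone (deriv (fun t : ℝ => g (x + t • v))) := by
    rw [← monotoneOn_univ]
    exact hcv.monotoneOn_deriv (fun t _ => (h1 t).differentiableAt)
  have he : deriv (fun t : ℝ => g (x + t • v)) = fun t => fderiv ℝ g (x + t • v) v := by
    ext t; exact (h1 t).deriv
  rw [he] at hm
  rw [← h2.deriv]
  exact hm.deriv_nonneg

theorem mt_trace {n : ℕ} {ι : Type} [Fintype ι] (c : ι → Euc n) {g : Euc n → ℝ}
    (hg : ContDiff ℝ 2 g) (hc : ConvexOn ℝ Set.univ g) (v : ι → ℝ) (x : Euc n) :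
    0 ≤ ∑ m, ∑ l, (mtH g (c m) (c m) x * (v l * v l) - mtH g (c l) (c m) x * (v m * v l)) := by
  classical
  let G : Matrix ι ι ℝ := Matrix.of fun m l => mtH g (c m) (c l) x
  have hq : ∀ y : ι → ℝ, ∑ m, ∑ l, y m * (G m l * y l) = mtH g (∑ m, y m • c m) (∑ m, y m • c m) x := by
    intro y
    rw [mtH_eq hg]
    simp only [map_sum, map_smul, sum_apply, smul_apply,
      smul_eq_mul, Finset.mul_sum]
    rw [Finset.sum_comm]
    refine Finset.sum_congr rfl fun m _ => Finset.sum_congr rfl fun l _ => ?_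
    simp only [G, Matrix.of_apply]
    rw [mtH_eq hg]; ring
  have hG : G.PosSemidef := by
    refine Matrix.PosSemidef.of_dotProduct_mulVec_nonneg ?_ ?_
    · ext m l
      simp only [Matrix.conjTranspose_apply, G, Matrix.of_apply, star_trivial]
      exact mt_symm hg.contDiffAt (c m) (c l)
    · intro y
      have : star y ⬝ᵥ G.mulVec y = ∑ m, ∑ l, y m * (G m l * y l) := by
        simp [dotProduct, Matrix.mulVec, Finset.mul_sum]
      rw [this, hq]
      exact mtH_nonneg hg hc _ _
  obtain ⟨B, hB⟩ := mt_factor hG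
  have hGB : ∀ m l, mtH g (c m) (c l) x = ∑ k, B k m * B k l := by
    intro m l
    have : G m l = (B.conjTranspose * B) m l := by rw [← hB]
    simpa [G, Matrix.mul_apply] using this
  have h1 : ∑ m, ∑ l, (mtH g (c m) (c m) x * (v l * v l) - mtH g (c l) (c m) x * (v m * v l))
      = ∑ k, ((∑ m, B k m ^ 2) * (∑ l, v l ^ 2) - (∑ m, B k m * v m) ^ 2) := by
    have e1 : ∀ k, (∑ m, B k m ^ 2) * (∑ l, v l ^ 2) - (∑ m, B k m * v m) ^ 2 =
        ∑ m, ∑ l, (B k m ^ 2 * v l ^ 2 - (B k m * v m) * (B k l * v l)) := by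
      intro k
      rw [sq (∑ m, B k m * v m), Finset.sum_mul_sum, Finset.sum_mul_sum]
      simp only [Finset.sum_sub_distrib]
    simp only [e1]
    symm
    rw [Finset.sum_comm]
    refine Finset.sum_congr rfl fun m _ => ?_
    rw [Finset.sum_comm]
    refine Finset.sum_congr rfl fun l _ => ?_
    rw [hGB, hGB, Finset.sum_mul, Finset.sum_mul, ← Finset.sum_sub_distrib]
    refine Finset.sum_congr rfl fun k _ => ?_
    ring
  rw [h1]
  refine Finset.sum_nonneg fun k _ => ?_
  have := Finset.sum_mul_sq_le_sq_mul_sq Finset.univ (fun m => B k m) v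
  linarith


theorem mt_ae_zero {n : ℕ} {Ω : Set (Euc n)} (hΩ : IsOpen Ω) {u : Euc n → ℝ}
    (hu : ContDiffOn ℝ 2 u Ω) (v : Euc n) :
    ∀ᵐ x ∂(volume.restrict Ω), u x = 0 → mtD u v x = 0 := by
  by_cases hv : v = 0
  · subst hv
    exact Eventually.of_forall fun x _ => by simp [mtD]
  have hm : MeasurableSet (Ω ∩ u ⁻¹' {0}) := by
    have h1 : IsOpen (Ω ∩ u ⁻¹' {0}ᶜ) :=
      hu.continuousOn.isOpen_inter_preimage hΩ isOpen_compl_singleton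
    have h2 : Ω ∩ u ⁻¹' {0} = Ω \ (Ω ∩ u ⁻¹' {0}ᶜ) := by
      ext x; simp
    rw [h2]
    exact hΩ.measurableSet.diff h1.measurableSet
  have happ : ApproximatesLinearOn (fun x => u x • v) (0 : Euc n →L[ℝ] Euc n) (Ω ∩ u ⁻¹' {0}) 0 := by
    intro x hx y hy
    have h1 : u x = 0 := hx.2
    have h2 : u y = 0 := hy.2
    simp [h1, h2]
  have h := happ.norm_fderiv_sub_le volume hm (fun x => (fderiv ℝ u x).smulRight v) (by
    intro x hx
    have hd : HasFDerivAt u (fderiv ℝ u x) x :=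
      ((hu.contDiffAt (hΩ.mem_nhds hx.1)).differentiableAt two_ne_zero).hasFDerivAt
    exact (hd.smul_const v).hasFDerivWithinAt)
  rw [ae_restrict_iff' hm] at h
  rw [ae_restrict_iff' hΩ.measurableSet]
  filter_upwards [h] with x hx hxΩ h0
  have := hx ⟨hxΩ, h0⟩
  have h3 : fderiv ℝ u x = 0 ∨ v = 0 := by
    simpa using this
  rcases h3 with h3 | h3
  · simp [mtD, h3]
  · exact absurd h3 hv

theorem mt_prim (s : ℝ → ℝ) (hs : ContDiff ℝ 1 s) :
    ∃ G : ℝ → ℝ, ContDiff ℝ 2 G ∧ (∀ t, HasDerivAt G (s t) t) ∧ ∀ t, G t = ∫ x in (0:ℝ)..t, s x := by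
  have hd : ∀ t, HasDerivAt (fun t => ∫ x in (0:ℝ)..t, s x) (s t) t := fun t =>
    intervalIntegral.integral_hasDerivAt_right (hs.continuous.intervalIntegrable _ _)
      hs.continuous.stronglyMeasurable.stronglyMeasurableAtFilter hs.continuous.continuousAt
  refine ⟨fun t => ∫ x in (0:ℝ)..t, s x, ?_, hd, fun _ => rfl⟩
  have : ContDiff ℝ (1 + 1) (fun t => ∫ x in (0:ℝ)..t, s x) := by
    rw [contDiff_succ_iff_deriv]
    refine ⟨fun t => (hd t).differentiableAt, by simp, ?_⟩
    rw [show deriv (fun t => ∫ x in (0:ℝ)..t, s x) = s from funext fun t => (hd t).deriv]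
    exact hs
  convert this using 1
  norm_num

theorem mt_cutG : ∃ G s : ℝ → ℝ, ContDiff ℝ 2 G ∧ (∀ t, HasDerivAt G (s t) t) ∧ Continuous s ∧
    (∀ t, |t| ≤ 1 → G t = 0) ∧ (∀ t, 0 ≤ s t) ∧ (∀ t, s t ≤ 1) ∧ (∀ t, 2 ≤ |t| → s t = 1) := by
  have hs : ContDiff ℝ 1 (fun t : ℝ => Real.smoothTransition (t ^ 2 - 1)) :=
    (Real.smoothTransition.contDiff (n := 1)).comp (by fun_prop)
  obtain ⟨G, hG, hd, hi⟩ := mt_prim _ hs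
  refine ⟨G, _, hG, hd, hs.continuous, ?_, fun t => Real.smoothTransition.nonneg _,
    fun t => Real.smoothTransition.le_one _, ?_⟩
  · intro t ht
    rw [hi]
    rw [intervalIntegral.integral_congr (g := fun _ => 0), intervalIntegral.integral_zero]
    intro x hx
    apply Real.smoothTransition.zero_of_nonpos
    have : |x| ≤ |t| := by
      rcases le_total 0 t with h | h
      · rw [Set.uIcc_of_le h] at hx
        rw [abs_of_nonneg hx.1, abs_of_nonneg h]; exact hx.2
      · rw [Set.uIcc_of_ge h] at hx
        rw [abs_of_nonpos hx.2, abs_of_nonpos h]; linarith [hx.1]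
    have := sq_abs x
    nlinarith [abs_nonneg x]
  · intro t ht
    apply Real.smoothTransition.one_of_one_le
    have := sq_abs t
    nlinarith

theorem mt_cutH : ∃ H s : ℝ → ℝ, ContDiff ℝ 2 H ∧ (∀ t, HasDerivAt H (s t) t) ∧ Continuous s ∧
    (∀ t, t ≤ 0 → H t = 0) ∧ (∀ t, 0 ≤ s t) ∧ (∀ t, s t ≤ 1) ∧ (∀ t, 1 ≤ t → s t = 1) ∧
    (∀ t, 0 ≤ t → |H t - t| ≤ 1) := by
  have hs : ContDiff ℝ 1 Real.smoothTransition := Real.smoothTransition.contDiff (n := 1)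
  obtain ⟨G, hG, hd, hi⟩ := mt_prim _ hs
  have hint : ∀ a b, IntervalIntegrable Real.smoothTransition volume a b := fun a b =>
    hs.continuous.intervalIntegrable _ _
  refine ⟨G, _, hG, hd, hs.continuous, ?_, fun t => Real.smoothTransition.nonneg _,
    fun t => Real.smoothTransition.le_one _, fun t ht => Real.smoothTransition.one_of_one_le ht, ?_⟩
  · intro t ht
    rw [hi]
    rw [intervalIntegral.integral_congr (g := fun _ => 0), intervalIntegral.integral_zero]
    intro x hx
    apply Real.smoothTransition.zero_of_nonpos
    rw [Set.uIcc_of_ge ht] at hx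
    exact hx.2
  · have key : ∀ t, 0 ≤ t → t ≤ 1 → |G t - t| ≤ 1 := by
      intro t ht ht1
      have h1 : G t - t = ∫ x in (0:ℝ)..t, (Real.smoothTransition x - 1) := by
        rw [intervalIntegral.integral_sub (hint _ _) (by simp), hi]; simp
      rw [h1]
      have := intervalIntegral.norm_integral_le_of_norm_le_const (a := (0:ℝ)) (b := t) (C := 1)
        (f := fun x => Real.smoothTransition x - 1) (by
          intro x _
          rw [Real.norm_eq_abs, abs_le]
          constructor <;> linarith [Real.smoothTransition.nonneg x, Real.smoothTransition.le_one x])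
      rw [Real.norm_eq_abs, sub_zero, abs_of_nonneg ht] at this
      linarith
    intro t ht
    rcases le_total t 1 with h | h
    · exact key t ht h
    · have h2 : G t = G 1 + (t - 1) := by
        rw [hi, hi, ← intervalIntegral.integral_add_adjacent_intervals (hint 0 1) (hint 1 t)]
        congr 1
        rw [intervalIntegral.integral_congr (g := fun _ => 1)]
        · simp
        · intro x hx
          rw [Set.uIcc_of_le h] at hx
          exact Real.smoothTransition.one_of_one_le hx.1
      have := key 1 (by norm_num) le_rfl
      rw [h2]
      convert this using 2
      ring


theorem mtD_contOn {n : ℕ} {Ω : Set (Euc n)} (hΩ : IsOpen Ω) {u : Euc n → ℝ}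
    (hu : ContDiffOn ℝ 2 u Ω) (v : Euc n) : ContinuousOn (mtD u v) Ω :=
  (hu.continuousOn_fderiv_of_isOpen hΩ (by norm_num)).clm_apply continuousOn_const

theorem mtH_contOn {n : ℕ} {Ω : Set (Euc n)} (hΩ : IsOpen Ω) {u : Euc n → ℝ}
    (hu : ContDiffOn ℝ 2 u Ω) (v w : Euc n) : ContinuousOn (mtH u v w) Ω := by
  have h1 : ContDiffOn ℝ 1 (fun y => fderiv ℝ u y w) Ω :=
    (hu.fderiv_of_isOpen hΩ (m := 1) (by norm_num)).clm_apply contDiffOn_const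
  exact (h1.continuousOn_fderiv_of_isOpen hΩ le_rfl).clm_apply continuousOn_const

theorem mt_w {n : ℕ} {Ω : Set (Euc n)} (hΩ : IsOpen Ω) (hb : Bornology.IsBounded Ω)
    {u : Euc n → ℝ} (hu : ContDiffOn ℝ 2 u Ω)
    (htr : ∀ x ∈ frontier Ω, Tendsto u (𝓝[Ω] x) (𝓝 0))
    {G s : ℝ → ℝ} (hG : ContDiff ℝ 2 G) (hGs : ∀ t, HasDerivAt G (s t) t)
    (hG0 : ∀ t, |t| ≤ 1 → G t = 0) {δ : ℝ} (hδ : 0 < δ) :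
    ∃ w : Euc n → ℝ, ContDiff ℝ 2 w ∧ HasCompactSupport w ∧ tsupport w ⊆ Ω ∧
      ∀ x ∈ Ω, ∀ v, mtD w v x = s (u x / δ) * mtD u v x := by
  classical
  set w : Euc n → ℝ := Ω.indicator (fun x => δ * G (u x / δ)) with hw
  set K : Set (Euc n) := {x | x ∈ Ω ∧ δ ≤ |u x|} with hKdef
  have hwΩ : ∀ x ∈ Ω, w =ᶠ[𝓝 x] fun x => δ * G (u x / δ) := by
    intro x hx
    filter_upwards [hΩ.mem_nhds hx] with y hy
    rw [hw, Set.indicator_of_mem hy]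
  have hwK : ∀ x ∉ K, w x = 0 := by
    intro x hx
    by_cases hxΩ : x ∈ Ω
    · have : |u x| < δ := by
        by_contra h
        exact hx ⟨hxΩ, not_lt.1 h⟩
      rw [hw, Set.indicator_of_mem hxΩ, hG0, mul_zero]
      rw [abs_div, abs_of_pos hδ, div_le_one hδ]
      exact this.le
    · rw [hw, Set.indicator_of_notMem hxΩ]
  have hKc : IsClosed K := by
    refine isClosed_of_closure_subset fun x hx => ?_
    rw [mem_closure_iff_frequently] at hx
    by_cases hxΩ : x ∈ Ω
    · refine ⟨hxΩ, ?_⟩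
      by_contra h
      have hc : ContinuousAt (fun y => |u y|) x := (hu.continuousOn.continuousAt (hΩ.mem_nhds hxΩ)).abs
      have := hc.eventually (gt_mem_nhds (not_le.1 h))
      obtain ⟨y, hy, hy2⟩ := (hx.and_eventually this).exists
      exact absurd hy.2 (not_le.2 hy2)
    · exfalso
      have hfr : x ∈ frontier Ω := by
        rw [hΩ.frontier_eq]
        refine ⟨?_, hxΩ⟩
        rw [mem_closure_iff_frequently]
        exact hx.mono fun y hy => hy.1
      have h1 := (htr x hfr).abs
      rw [abs_zero] at h1
      have h2 := h1.eventually (gt_mem_nhds hδ)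
      rw [eventually_nhdsWithin_iff] at h2
      obtain ⟨y, hy, hy2⟩ := (hx.and_eventually h2).exists
      exact absurd hy.2 (not_le.2 (hy2 hy.1))
  have hKcpt : IsCompact K := Metric.isCompact_of_isClosed_isBounded hKc (hb.subset fun x hx => hx.1)
  have hsupp : tsupport w ⊆ K := by
    refine closure_minimal (fun x hx => ?_) hKc
    by_contra h
    exact hx (hwK x h)
  refine ⟨w, ?_, hKcpt.of_isClosed_subset (isClosed_tsupport _) hsupp, hsupp.trans fun x hx => hx.1, ?_⟩
  · rw [contDiff_iff_contDiffAt]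
    intro x
    by_cases hx : x ∈ Ω
    · refine ContDiffAt.congr_of_eventuallyEq ?_ (hwΩ x hx)
      refine contDiffAt_const.mul (hG.contDiffAt.comp x ?_)
      exact (hu.contDiffAt (hΩ.mem_nhds hx)).div_const δ
    · have : w =ᶠ[𝓝 x] fun _ => 0 := by
        filter_upwards [hKc.isOpen_compl.mem_nhds (fun h => hx h.1 : x ∈ Kᶜ)] with y hy
        exact hwK y hy
      exact contDiffAt_const.congr_of_eventuallyEq this
  · intro x hx v
    rw [mtD_congr (hwΩ x hx)]
    have hd : HasFDerivAt u (fderiv ℝ u x) x :=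
      ((hu.contDiffAt (hΩ.mem_nhds hx)).differentiableAt two_ne_zero).hasFDerivAt
    have h1 : HasFDerivAt (fun y => u y / δ) (δ⁻¹ • fderiv ℝ u x) x := by
      simpa [div_eq_mul_inv] using hd.mul_const δ⁻¹
    have h2 := ((hGs (u x / δ)).comp_hasFDerivAt x h1).const_mul δ
    unfold mtD
    have h3 : fderiv ℝ (fun x => δ * G (u x / δ)) x = δ • s (u x / δ) • δ⁻¹ • fderiv ℝ u x := h2.fderiv
    rw [h3]
    simp only [smul_apply, smul_eq_mul]
    field_simp

theorem mt_stepA {n : ℕ} {ι : Type} [Fintype ι] (c : ι → Euc n) {Ω : Set (Euc n)}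
    (hΩ : IsOpen Ω) (hb : Bornology.IsBounded Ω)
    {u : Euc n → ℝ} (hu : ContDiffOn ℝ 2 u Ω)
    (htr : ∀ x ∈ frontier Ω, Tendsto u (𝓝[Ω] x) (𝓝 0))
    (hV : ∀ m, IntegrableOn (mtV c u m) Ω)
    {g : Euc n → ℝ} (hg : ContDiff ℝ 2 g) (hgc : ConvexOn ℝ Set.univ g) {K : ℝ}
    (hK : ∀ x v, |fderiv ℝ g x v| ≤ K * ‖v‖) :
    0 ≤ ∫ x in Ω, ∑ m, mtD g (c m) x * mtV c u m x := by
  obtain ⟨G, s, hG, hGs, hsc, hG0, hs0, hs1, hs2⟩ := mt_cutG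
  have hgcont : ∀ v, Continuous (mtD g v) := fun v => (mt_fderiv_apply_contDiff hg v).continuous
  have hint : IntegrableOn (fun x => ∑ m, mtD g (c m) x * mtV c u m x) Ω := by
    refine integrable_finsetSum _ fun m _ => ?_
    refine (hV m).bdd_mul (c := K * ‖c m‖) (hgcont (c m)).aestronglyMeasurable ?_
    exact Eventually.of_forall fun x => hK x (c m)
  have hδ : ∀ j : ℕ, (0:ℝ) < 1 / ((j:ℝ) + 1) := fun j => by positivity
  have hcontu : ContinuousOn u Ω := hu.continuousOn
  have hlim : Tendsto (fun j : ℕ => ∫ x in Ω, s (u x / (1 / ((j:ℝ) + 1))) *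
      ∑ m, mtD g (c m) x * mtV c u m x) atTop (𝓝 (∫ x in Ω, ∑ m, mtD g (c m) x * mtV c u m x)) := by
    refine tendsto_integral_of_dominated_convergence
      (fun x => ‖∑ m, mtD g (c m) x * mtV c u m x‖) ?_ hint.norm ?_ ?_
    · intro j
      refine AEStronglyMeasurable.mul ?_ hint.aestronglyMeasurable
      refine ContinuousOn.aestronglyMeasurable ?_ hΩ.measurableSet
      exact hsc.comp_continuousOn (hcontu.div_const _)
    · intro j
      refine Eventually.of_forall fun x => ?_
      rw [norm_mul, Real.norm_eq_abs, abs_of_nonneg (hs0 _)]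
      exact mul_le_of_le_one_left (norm_nonneg _) (hs1 _)
    · have hae : ∀ᵐ x ∂(volume.restrict Ω), ∀ m, u x = 0 → mtD u (c m) x = 0 :=
        ae_all_iff.2 fun m => mt_ae_zero hΩ hu (c m)
      filter_upwards [hae] with x hx
      by_cases h0 : u x = 0
      · have : ∑ m, mtD g (c m) x * mtV c u m x = 0 := by
          refine Finset.sum_eq_zero fun m _ => ?_
          simp [mtV, hx _ h0]
        simp [this]
      · refine tendsto_const_nhds.congr' ?_
        have h1 : Tendsto (fun j : ℕ => |u x| * ((j:ℝ) + 1)) atTop atTop :=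
          (tendsto_atTop_add_const_right _ _ tendsto_natCast_atTop_atTop).const_mul_atTop (abs_pos.2 h0)
        filter_upwards [h1.eventually_ge_atTop 2] with j hj
        rw [hs2, one_mul]
        rw [abs_div, abs_of_pos (hδ j), div_div_eq_mul_div, div_one]
        exact hj
  refine ge_of_tendsto' hlim fun j => ?_
  obtain ⟨w, hw, hwc, hwΩ, hwd⟩ := mt_w hΩ hb hu htr hG hGs hG0 (hδ j)
  have hL := mt_L2' c hΩ g w u hg hw hwc hwΩ hu
  set S : Euc n → ℝ := fun x => s (u x / (1 / ((j:ℝ) + 1))) with hS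
  have e1 : ∫ x in Ω, (S x * ∑ m, mtD g (c m) x * mtV c u m x - S x * ∑ m, ∑ l,
      (mtH g (c m) (c m) x * (mtD u (c l) x * mtD u (c l) x) -
        mtH g (c l) (c m) x * (mtD u (c m) x * mtD u (c l) x))) = 0 := by
    rw [← hL]
    refine setIntegral_congr_fun hΩ.measurableSet fun x hx => ?_
    simp only [hwd x hx, mtV, Finset.mul_sum, ← Finset.sum_sub_distrib]
    refine Finset.sum_congr rfl fun m _ => Finset.sum_congr rfl fun l _ => ?_
    simp only [hS]
    ring
  set T : Euc n → ℝ := fun x => S x * ∑ m, ∑ l,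
      (mtH g (c m) (c m) x * (mtD u (c l) x * mtD u (c l) x) -
        mtH g (c l) (c m) x * (mtD u (c m) x * mtD u (c l) x)) with hT
  have hScont : ContinuousOn S Ω := hsc.comp_continuousOn (hcontu.div_const _)
  have hDu := mtD_contOn hΩ hu
  have hHg : ∀ v w, Continuous (mtH g v w) := fun v w => by
    rw [← continuousOn_univ]
    exact mtH_contOn isOpen_univ hg.contDiffOn v w
  have hTcont : ContinuousOn T Ω := by
    refine hScont.mul ?_
    refine continuousOn_finset_sum _ fun m _ => continuousOn_finset_sum _ fun l _ => ?_
    exact ((hHg _ _).continuousOn.mul ((hDu _).mul (hDu _))).sub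
      ((hHg _ _).continuousOn.mul ((hDu _).mul (hDu _)))
  have hTint : IntegrableOn T Ω := by
    refine IntegrableOn.of_forall_diff_eq_zero
      ((hTcont.mono hwΩ).integrableOn_compact hwc) hΩ.measurableSet fun x hx => ?_
    have hz : ∀ v, S x * mtD u v x = 0 := by
      intro v
      rw [← hwd x hx.1]
      have : w =ᶠ[𝓝 x] fun _ => 0 := notMem_tsupport_iff_eventuallyEq.1 hx.2
      rw [mtD_congr this]
      simp [mtD]
    simp only [hT, Finset.mul_sum]
    refine Finset.sum_eq_zero fun m _ => Finset.sum_eq_zero fun l _ => ?_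
    linear_combination (mtH g (c m) (c m) x * mtD u (c l) x) * hz (c l) -
      (mtH g (c l) (c m) x * mtD u (c l) x) * hz (c m)
  have hSint : IntegrableOn (fun x => S x * ∑ m, mtD g (c m) x * mtV c u m x) Ω := by
    refine Integrable.bdd_mul (c := 1) hint (hScont.aestronglyMeasurable hΩ.measurableSet) ?_
    refine Eventually.of_forall fun x => ?_
    rw [Real.norm_eq_abs, abs_of_nonneg (hs0 _)]
    exact hs1 _
  rw [integral_sub hSint hTint, sub_eq_zero] at e1
  rw [e1]
  refine integral_nonneg fun x => ?_
  exact mul_nonneg (hs0 _) (mt_trace c hg hgc (fun m => mtD u (c m) x) x)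


theorem mt_stepB {n : ℕ} {ι : Type} [Fintype ι] (c : ι → Euc n) {Ω : Set (Euc n)}
    (hΩ : IsOpen Ω) (hb : Bornology.IsBounded Ω)
    {u : Euc n → ℝ} (hu : ContDiffOn ℝ 2 u Ω)
    (htr : ∀ x ∈ frontier Ω, Tendsto u (𝓝[Ω] x) (𝓝 0))
    (hV : ∀ m, IntegrableOn (mtV c u m) Ω) (hJ : IntegrableOn (mtJ c u) Ω)
    {f : Euc n → ℝ} {K : NNReal} (hK : 0 < K) (hf : ConvexOn ℝ Set.univ f) (hL : LipschitzWith K f)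
    (hf0 : ∀ x, 0 ≤ f x) (hf1 : ∀ x, x ∈ Ω ↔ f x < 1) :
    0 ≤ ∫ x in Ω, (1 - f x) * mtJ c u x := by
  obtain ⟨H, s, hH, hHs, hsc, hH0, hs0, hs1, hs2, hH1⟩ := mt_cutH
  set ε : ℕ → ℝ := fun j => K * (1 / ((j:ℝ) + 1)) with hε
  have hεpos : ∀ j, 0 < ε j := fun j => by
    have : (0:ℝ) < K := hK
    simp only [hε]; positivity
  have hεle : ∀ j, ε j ≤ K := fun j => by
    simp only [hε]
    refine mul_le_of_le_one_right K.coe_nonneg ?_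
    rw [div_le_one (by positivity)]
    have : (0:ℝ) ≤ j := Nat.cast_nonneg j
    linarith
  have hεlim : Tendsto ε atTop (𝓝 0) := by
    have := (tendsto_one_div_add_atTop_nhds_zero_nat (𝕜 := ℝ)).const_mul (K:ℝ)
    rw [mul_zero] at this
    exact this
  have hex : ∀ j : ℕ, ∃ g : Euc n → ℝ, ContDiff ℝ 2 g ∧ ConvexOn ℝ Set.univ g ∧
      (∀ x v, |fderiv ℝ g x v| ≤ K * ‖v‖) ∧ ∀ x, |g x - f x| ≤ ε j := fun j =>
    mt_smooth_convex hf hL (by positivity)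
  choose g hg hgc hgK hgf using hex
  set φ : ℕ → Euc n → ℝ := fun j x => 1 - g j x - 2 * ε j with hφ
  set ψ : ℕ → Euc n → ℝ := fun j x => ε j * H (φ j x / ε j) with hψ
  have hφf : ∀ j x, |φ j x - (1 - f x)| ≤ 3 * ε j := by
    intro j x
    have := abs_le.1 (hgf j x)
    have h2 := hεpos j
    simp only [hφ]
    rw [abs_le]
    constructor <;> linarith [this.1, this.2]
  have hψ0 : ∀ j x, φ j x ≤ 0 → ψ j x = 0 := by
    intro j x h
    simp only [hψ]
    rw [hH0 _ (div_nonpos_of_nonpos_of_nonneg h (hεpos j).le), mul_zero]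
  have hψf : ∀ j, ∀ x ∈ Ω, |ψ j x - (1 - f x)| ≤ 6 * ε j := by
    intro j x hx
    have h1 := (hf1 x).1 hx
    have h2 := abs_le.1 (hφf j x)
    have h3 := hεpos j
    rcases le_total (φ j x) 0 with h | h
    · rw [hψ0 j x h, abs_le]
      constructor <;> linarith [h2.1, h2.2]
    · have h4 := hH1 (φ j x / ε j) (by positivity)
      have h5 : |ψ j x - φ j x| ≤ ε j := by
        have : ψ j x - φ j x = ε j * (H (φ j x / ε j) - φ j x / ε j) := by
          simp only [hψ]; field_simp
        rw [this, abs_mul, abs_of_pos h3]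
        exact mul_le_of_le_one_right h3.le h4
      rw [abs_le] at h5 ⊢
      constructor <;> linarith [h2.1, h2.2, h5.1, h5.2]
  have hfc : Continuous f := hL.continuous
  have hgD : ∀ j v, Continuous (mtD (g j) v) := fun j v =>
    (mt_fderiv_apply_contDiff (hg j) v).continuous
  have hφc : ∀ j, Continuous (φ j) := fun j =>
    (continuous_const.sub (hg j).continuous).sub continuous_const
  have hψC : ∀ j, ContDiff ℝ 2 (ψ j) := fun j => by
    refine contDiff_const.mul (hH.comp ?_)
    exact ((contDiff_const.sub (hg j)).sub contDiff_const).div_const _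
  have hψD : ∀ j x v, mtD (ψ j) v x = - (s (φ j x / ε j) * mtD (g j) v x) := by
    intro j x v
    have hd : HasFDerivAt (g j) (fderiv ℝ (g j) x) x :=
      ((hg j).differentiable two_ne_zero x).hasFDerivAt
    have h0 : HasFDerivAt (φ j) (-fderiv ℝ (g j) x) x := (hd.const_sub 1).sub_const _
    have h1 : HasFDerivAt (fun y => φ j y / ε j) ((ε j)⁻¹ • (-fderiv ℝ (g j) x)) x := by
      simpa [div_eq_mul_inv] using h0.mul_const (ε j)⁻¹
    have h2 := ((hHs (φ j x / ε j)).comp_hasFDerivAt x h1).const_mul (ε j)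
    have h3 : fderiv ℝ (ψ j) x = ε j • s (φ j x / ε j) • (ε j)⁻¹ • (-fderiv ℝ (g j) x) := h2.fderiv
    unfold mtD
    rw [h3]
    have := (hεpos j).ne'
    simp only [smul_apply, neg_apply, smul_eq_mul]
    field_simp
  have hψsupp : ∀ j, HasCompactSupport (ψ j) ∧ tsupport (ψ j) ⊆ Ω := by
    intro j
    have hcl : IsClosed {x | f x ≤ 1 - ε j} := isClosed_le hfc continuous_const
    have hsub : {x | f x ≤ 1 - ε j} ⊆ Ω := by
      intro x hx
      rw [hf1]
      have := hεpos j
      have hx' : f x ≤ 1 - ε j := hx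
      linarith
    have hts : tsupport (ψ j) ⊆ {x | f x ≤ 1 - ε j} := by
      refine closure_minimal (fun x hx => ?_) hcl
      by_contra h
      refine hx (hψ0 j x ?_)
      have h' : ¬ f x ≤ 1 - ε j := h
      have := abs_le.1 (hgf j x)
      simp only [hφ]
      linarith [this.1]
    exact ⟨(Metric.isCompact_of_isClosed_isBounded hcl (hb.subset hsub)).of_isClosed_subset
      (isClosed_tsupport _) hts, hts.trans hsub⟩
  set F : ℕ → Euc n → ℝ := fun j x => ∑ m, mtD (g j) (c m) x * mtV c u m x with hF
  have hFint : ∀ j, IntegrableOn (F j) Ω := by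
    intro j
    refine integrable_finsetSum _ fun m _ => ?_
    refine (hV m).bdd_mul (c := K * ‖c m‖) (hgD j (c m)).aestronglyMeasurable ?_
    exact Eventually.of_forall fun x => hgK j x (c m)
  have hFA : ∀ j, 0 ≤ ∫ x in Ω, F j x := fun j =>
    mt_stepA c hΩ hb hu htr hV (hg j) (hgc j) (hgK j)
  set R : ℕ → Euc n → ℝ := fun j x => (1 - s (φ j x / ε j)) * F j x with hR
  have hRcont : ∀ j, Continuous (fun x => 1 - s (φ j x / ε j)) := fun j =>
    continuous_const.sub (hsc.comp ((hφc j).div_const _))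
  have hRb : ∀ j x, |1 - s (φ j x / ε j)| ≤ 1 := by
    intro j x
    rw [abs_le]
    constructor <;> linarith [hs0 (φ j x / ε j), hs1 (φ j x / ε j)]
  have hRint : ∀ j, IntegrableOn (R j) Ω := fun j =>
    (hFint j).bdd_mul (c := 1) (hRcont j).aestronglyMeasurable (Eventually.of_forall fun x => hRb j x)
  have hψb : ∀ j, ∀ x ∈ Ω, |ψ j x| ≤ 1 + 6 * K := by
    intro j x hx
    have h1 := abs_le.1 (hψf j x hx)
    have h2 := (hf1 x).1 hx
    have h3 := hf0 x
    have h4 := hεle j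
    rw [abs_le]
    constructor <;> linarith [h1.1, h1.2]
  have hψJint : ∀ j, IntegrableOn (fun x => ψ j x * mtJ c u x) Ω := by
    intro j
    refine Integrable.bdd_mul (c := 1 + 6 * K) hJ (hψC j).continuous.aestronglyMeasurable ?_
    filter_upwards [ae_restrict_mem hΩ.measurableSet] with x hx
    exact hψb j x hx
  have key : ∀ j, 0 ≤ (∫ x in Ω, ψ j x * mtJ c u x) + ∫ x in Ω, R j x := by
    intro j
    have h1 := mt_L1' c hΩ (ψ j) u ((hψC j).of_le (by norm_num)) (hψsupp j).1 (hψsupp j).2 hu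
    have h2 : ∫ x in Ω, (ψ j x * mtJ c u x + ∑ m, mtD (ψ j) (c m) x * mtV c u m x) =
        ∫ x in Ω, (ψ j x * mtJ c u x + R j x - F j x) := by
      congr 1
      ext x
      have : ∑ m, mtD (ψ j) (c m) x * mtV c u m x = R j x - F j x := by
        simp only [hR, hF, hψD]
        rw [sub_mul, one_mul, sub_sub_cancel_left, Finset.mul_sum, ← Finset.sum_neg_distrib]
        exact Finset.sum_congr rfl fun m _ => by ring
      rw [this]; ring
    have h3 : IntegrableOn (fun x => ψ j x * mtJ c u x + R j x) Ω := (hψJint j).add (hRint j)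
    rw [h2, integral_sub h3 (hFint j),
      integral_add (hψJint j) (hRint j)] at h1
    linarith [hFA j]
  have lim1 : Tendsto (fun j => ∫ x in Ω, ψ j x * mtJ c u x) atTop
      (𝓝 (∫ x in Ω, (1 - f x) * mtJ c u x)) := by
    refine tendsto_integral_of_dominated_convergence (fun x => (1 + 6 * K) * ‖mtJ c u x‖)
      (fun j => (hψJint j).aestronglyMeasurable) (hJ.norm.const_mul _) ?_ ?_
    · intro j
      filter_upwards [ae_restrict_mem hΩ.measurableSet] with x hx
      rw [norm_mul]
      exact mul_le_mul_of_nonneg_right (hψb j x hx) (norm_nonneg _)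
    · filter_upwards [ae_restrict_mem hΩ.measurableSet] with x hx
      refine Tendsto.mul_const _ ?_
      rw [tendsto_iff_norm_sub_tendsto_zero]
      refine squeeze_zero (fun _ => norm_nonneg _) (fun j => hψf j x hx) ?_
      simpa using hεlim.const_mul 6
  have lim2 : Tendsto (fun j => ∫ x in Ω, R j x) atTop (𝓝 (∫ x in Ω, (0:ℝ))) := by
    refine tendsto_integral_of_dominated_convergence
      (fun x => ∑ m, K * ‖c m‖ * ‖mtV c u m x‖)
      (fun j => (hRint j).aestronglyMeasurable)
      (integrable_finsetSum _ fun m _ => (hV m).norm.const_mul _) ?_ ?_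
    · intro j
      refine Eventually.of_forall fun x => ?_
      have h1 : ‖R j x‖ ≤ ‖F j x‖ := by
        simp only [hR]
        rw [norm_mul]
        exact mul_le_of_le_one_left (norm_nonneg _) (hRb j x)
      refine h1.trans ((norm_sum_le _ _).trans (Finset.sum_le_sum fun m _ => ?_))
      rw [norm_mul]
      exact mul_le_mul_of_nonneg_right (hgK j x (c m)) (norm_nonneg _)
    · filter_upwards [ae_restrict_mem hΩ.measurableSet] with x hx
      refine tendsto_const_nhds.congr' ?_
      have h1 := (hf1 x).1 hx
      have h2 := hεlim.eventually (gt_mem_nhds (show (0:ℝ) < (1 - f x) / 4 by linarith))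
      filter_upwards [h2] with j hj
      have h3 := abs_le.1 (hφf j x)
      simp only [hR]
      rw [hs2, sub_self, zero_mul]
      rw [le_div_iff₀ (hεpos j)]
      linarith [h3.1]
  have lim := lim1.add lim2
  rw [integral_zero, add_zero] at lim
  exact ge_of_tendsto' lim key

theorem mt_stepC {n : ℕ} {ι : Type} [Fintype ι] (c : ι → Euc n) {Ω : Set (Euc n)}
    (hΩ : IsOpen Ω) (hcv : Convex ℝ Ω) (hb : Bornology.IsBounded Ω)
    {u : Euc n → ℝ} (hu : ContDiffOn ℝ 2 u Ω)
    (htr : ∀ x ∈ frontier Ω, Tendsto u (𝓝[Ω] x) (𝓝 0))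
    (hV : ∀ m, IntegrableOn (mtV c u m) Ω) (hJ : IntegrableOn (mtJ c u) Ω) :
    0 ≤ ∫ x in Ω, mtJ c u x := by
  rcases Ω.eq_empty_or_nonempty with he | ⟨x0, hx0⟩
  · simp [he]
  set S : Set (Euc n) := (fun y => x0 + y) ⁻¹' Ω with hS
  have hSo : IsOpen S := hΩ.preimage (by fun_prop)
  have hS0 : (0 : Euc n) ∈ S := by simpa [hS] using hx0
  have hSc : Convex ℝ S := hcv.translate_preimage_right x0
  have hSn : S ∈ 𝓝 (0 : Euc n) := hSo.mem_nhds hS0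
  obtain ⟨L, hL⟩ := hSc.lipschitz_gauge hSn
  set p : Euc n → ℝ := fun x => gauge S (x - x0) with hp
  have hpL : LipschitzWith L p := by
    have := hL.comp ((LipschitzWith.id (α := Euc n)).sub (LipschitzWith.const x0))
    rw [add_zero, mul_one] at this
    exact this
  have hp0 : ∀ x, 0 ≤ p x := fun x => gauge_nonneg _
  have hp1 : ∀ x, x ∈ Ω ↔ p x < 1 := by
    intro x
    have h := setOfPred_gauge_lt_one_eq_self_of_isOpen hSc hS0 hSo
    have h2 : x ∈ Ω ↔ x - x0 ∈ S := by simp [hS]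
    rw [h2]
    nth_rewrite 1 [← h]
    rfl
  have hpc : ConvexOn ℝ Set.univ p := by
    refine ⟨convex_univ, fun x _ y _ a b ha hb hab => ?_⟩
    have e : a • x + b • y - x0 = a • (x - x0) + b • (y - x0) := by
      have : x0 = (a + b) • x0 := by rw [hab, one_smul]
      nth_rewrite 1 [this]
      module
    simp only [hp]
    rw [e]
    refine (gauge_add_le hSc (absorbent_nhds_zero hSn) _ _).trans ?_
    rw [gauge_smul_of_nonneg ha, gauge_smul_of_nonneg hb]
  set f : ℕ → Euc n → ℝ := fun k x => max 0 ((k + 1) * p x - k) with hf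
  have hB : ∀ k, 0 ≤ ∫ x in Ω, (1 - f k x) * mtJ c u x := by
    intro k
    refine mt_stepB c hΩ hb hu htr hV hJ (f := f k) (K := (k + 1) * L + 1) (by positivity) ?_ ?_
      (fun x => le_max_left _ _) ?_
    · refine (convexOn_const _ convex_univ).sup ?_
      have := (hpc.smul (show (0:ℝ) ≤ k + 1 by positivity)).add_const (-(k:ℝ))
      refine this.congr fun x _ => ?_
      simp [sub_eq_add_neg]
    · have h1 : LipschitzWith ((k + 1) * L) (fun x => ((k:ℝ) + 1) * p x - k) := by
        refine LipschitzWith.of_dist_le_mul fun x y => ?_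
        have := hpL.dist_le_mul x y
        rw [Real.dist_eq] at this ⊢
        rw [show ((k:ℝ) + 1) * p x - k - (((k:ℝ) + 1) * p y - k) = (k + 1) * (p x - p y) by ring,
          abs_mul, abs_of_pos (by positivity)]
        push_cast
        rw [mul_assoc]
        exact mul_le_mul_of_nonneg_left this (by positivity)
      exact (h1.const_max 0).weaken (by simp)
    · intro x
      rw [hp1]
      have hk : (0:ℝ) < k + 1 := by positivity
      simp only [hf, max_lt_iff, zero_lt_one, true_and]
      constructor
      · intro h; nlinarith
      · intro h; nlinarith
  have hfc : ∀ k, Continuous (f k) := fun k =>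
    continuous_const.max ((continuous_const.mul hpL.continuous).sub continuous_const)
  have lim : Tendsto (fun k => ∫ x in Ω, (1 - f k x) * mtJ c u x) atTop (𝓝 (∫ x in Ω, mtJ c u x)) := by
    refine tendsto_integral_of_dominated_convergence (fun x => ‖mtJ c u x‖)
      (fun k => (continuous_const.sub (hfc k)).aestronglyMeasurable.mul hJ.aestronglyMeasurable)
      hJ.norm ?_ ?_
    · intro k
      filter_upwards [ae_restrict_mem hΩ.measurableSet] with x hx
      rw [norm_mul]
      refine mul_le_of_le_one_left (norm_nonneg _) ?_
      have h1 := (hp1 x).1 hx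
      have hk : (0:ℝ) < k + 1 := by positivity
      have h2 : f k x ≤ 1 := max_le zero_le_one (by nlinarith)
      have h3 : 0 ≤ f k x := le_max_left _ _
      rw [Real.norm_eq_abs, abs_le]
      constructor <;> linarith
    · filter_upwards [ae_restrict_mem hΩ.measurableSet] with x hx
      refine tendsto_const_nhds.congr' ?_
      have h1 := (hp1 x).1 hx
      have h2 : Tendsto (fun k : ℕ => (k:ℝ) * (1 - p x)) atTop atTop :=
        tendsto_natCast_atTop_atTop.atTop_mul_const (by linarith)
      filter_upwards [h2.eventually_ge_atTop (p x)] with k hk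
      have : f k x = 0 := max_eq_left (by linarith)
      rw [this]; ring
  exact ge_of_tendsto' lim hB


theorem mtD_expand {n : ℕ} (f : Euc n → ℝ) (v x : Euc n) :
    mtD f v x = ∑ i, v i * mtD f (EuclideanSpace.single i 1) x := by
  have hv : v = ∑ i, v i • EuclideanSpace.single i (1:ℝ) := by
    ext j
    simp [Finset.sum_apply, Pi.single_apply]
  unfold mtD
  conv_lhs => rw [hv]
  simp only [map_sum, map_smul, smul_eq_mul]

theorem mtH_expand1 {n : ℕ} (f : Euc n → ℝ) (v w x : Euc n) :
    mtH f v w x = ∑ i, v i * mtH f (EuclideanSpace.single i 1) w x :=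
  mtD_expand (fun y => fderiv ℝ f y w) v x

theorem mtH_symm {n : ℕ} {Ω : Set (Euc n)} (hΩ : IsOpen Ω) {f : Euc n → ℝ}
    (hf : ContDiffOn ℝ 2 f Ω) {x : Euc n} (hx : x ∈ Ω) (v w : Euc n) :
    mtH f v w x = mtH f w v x :=
  mt_symm (hf.contDiffAt (hΩ.mem_nhds hx)) w v

theorem mtH_expand2 {n : ℕ} {Ω : Set (Euc n)} (hΩ : IsOpen Ω) {f : Euc n → ℝ}
    (hf : ContDiffOn ℝ 2 f Ω) {x : Euc n} (hx : x ∈ Ω) (v w : Euc n) :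
    mtH f v w x = ∑ j, w j * mtH f v (EuclideanSpace.single j 1) x := by
  rw [mtH_symm hΩ hf hx, mtH_expand1]
  exact Finset.sum_congr rfl fun j _ => by rw [mtH_symm hΩ hf hx]

theorem mtD_lin {n : ℕ} {κ : Type} [Fintype κ] {Ω : Set (Euc n)} (hΩ : IsOpen Ω)
    {u : κ → Euc n → ℝ} (hu : ∀ α, ContDiffOn ℝ 2 (u α) Ω) (e : κ → ℝ) {x : Euc n} (hx : x ∈ Ω)
    (v : Euc n) : mtD (fun y => ∑ α, e α * u α y) v x = ∑ α, e α * mtD (u α) v x := by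
  have h : HasFDerivAt (fun y => ∑ α, e α * u α y) (∑ α, e α • fderiv ℝ (u α) x) x := by
    refine HasFDerivAt.fun_sum fun α _ => ?_
    exact (((hu α).contDiffAt (hΩ.mem_nhds hx)).differentiableAt two_ne_zero).hasFDerivAt.const_mul _
  unfold mtD
  rw [h.fderiv]
  simp

theorem mtH_lin {n : ℕ} {κ : Type} [Fintype κ] {Ω : Set (Euc n)} (hΩ : IsOpen Ω)
    {u : κ → Euc n → ℝ} (hu : ∀ α, ContDiffOn ℝ 2 (u α) Ω) (e : κ → ℝ) {x : Euc n} (hx : x ∈ Ω)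
    (v w : Euc n) : mtH (fun y => ∑ α, e α * u α y) v w x = ∑ α, e α * mtH (u α) v w x := by
  have h0 : (fun y => fderiv ℝ (fun y => ∑ α, e α * u α y) y w) =ᶠ[𝓝 x]
      fun y => ∑ α, e α * fderiv ℝ (u α) y w := by
    filter_upwards [hΩ.mem_nhds hx] with y hy
    exact mtD_lin hΩ hu e hy w
  have h1 : ∀ α, DifferentiableAt ℝ (fun y => fderiv ℝ (u α) y w) x := fun α =>
    ((((hu α).fderiv_of_isOpen hΩ (m := 1) (by norm_num)).clm_apply contDiffOn_const).contDiffAt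
      (hΩ.mem_nhds hx)).differentiableAt one_ne_zero
  have h : HasFDerivAt (fun y => ∑ α, e α * fderiv ℝ (u α) y w)
      (∑ α, e α • fderiv ℝ (fun y => fderiv ℝ (u α) y w) x) x := by
    refine HasFDerivAt.fun_sum fun α _ => ?_
    exact (h1 α).hasFDerivAt.const_mul _
  unfold mtH
  rw [h0.fderiv_eq, h.fderiv]
  simp

theorem mt_coer {n : ℕ} {ι : Type} [Fintype ι] (c : ι → Euc n) {Ω : Set (Euc n)} (hΩ : IsOpen Ω)
    {f : Euc n → ℝ} (hf : ContDiffOn ℝ 2 f Ω) {ν : ℝ} (hν : 0 ≤ ν)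
    (hc : ∀ y : Fin n → ℝ, ν * ∑ i, y i ^ 2 ≤ ∑ m, (∑ i, c m i * y i) ^ 2)
    {x : Euc n} (hx : x ∈ Ω) :
    ν ^ 2 * ∑ i, ∑ j, mtH f (EuclideanSpace.single i 1) (EuclideanSpace.single j 1) x ^ 2 ≤
      ∑ m, ∑ l, mtH f (c m) (c l) x ^ 2 := by
  have key : ∀ w, ν * ∑ i, mtH f (EuclideanSpace.single i 1) w x ^ 2 ≤ ∑ m, mtH f (c m) w x ^ 2 := by
    intro w
    refine (hc fun i => mtH f (EuclideanSpace.single i 1) w x).trans_eq ?_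
    exact Finset.sum_congr rfl fun m _ => by rw [mtH_expand1 f (c m)]
  calc ν ^ 2 * ∑ i, ∑ j, mtH f (EuclideanSpace.single i 1) (EuclideanSpace.single j 1) x ^ 2
      = ∑ j, ν * (ν * ∑ i, mtH f (EuclideanSpace.single i 1) (EuclideanSpace.single j 1) x ^ 2) := by
        rw [Finset.sum_comm, Finset.mul_sum]
        exact Finset.sum_congr rfl fun j _ => by ring
    _ ≤ ∑ j, ν * ∑ m, mtH f (c m) (EuclideanSpace.single j 1) x ^ 2 :=
        Finset.sum_le_sum fun j _ => mul_le_mul_of_nonneg_left (key _) hν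
    _ = ∑ m, ν * ∑ j, mtH f (EuclideanSpace.single j 1) (c m) x ^ 2 := by
        simp only [Finset.mul_sum]
        rw [Finset.sum_comm]
        refine Finset.sum_congr rfl fun m _ => Finset.sum_congr rfl fun j _ => ?_
        rw [mtH_symm hΩ hf hx]
    _ ≤ ∑ m, ∑ l, mtH f (c l) (c m) x ^ 2 := Finset.sum_le_sum fun m _ => key _
    _ = _ := Finset.sum_comm

theorem mt_scalar {n : ℕ} {ι : Type} [Fintype ι] (c : ι → Euc n) {Ω : Set (Euc n)}
    (hΩ : IsOpen Ω) (hcv : Convex ℝ Ω) (hb : Bornology.IsBounded Ω)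
    {u : Euc n → ℝ} (hu : ContDiffOn ℝ 2 u Ω)
    (htr : ∀ x ∈ frontier Ω, Tendsto u (𝓝[Ω] x) (𝓝 0))
    (hD : ∀ i, MemLp (mtD u (EuclideanSpace.single i 1)) 2 (volume.restrict Ω))
    (hH : ∀ i j, MemLp (mtH u (EuclideanSpace.single i 1) (EuclideanSpace.single j 1)) 2
      (volume.restrict Ω)) {ν : ℝ} (hν : 0 ≤ ν)
    (hc : ∀ y : Fin n → ℝ, ν * ∑ i, y i ^ 2 ≤ ∑ m, (∑ i, c m i * y i) ^ 2) :
    ν ^ 2 * ∫ x in Ω, ∑ i, ∑ j,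
        mtH u (EuclideanSpace.single i 1) (EuclideanSpace.single j 1) x ^ 2 ≤
      ∫ x in Ω, (∑ m, mtH u (c m) (c m) x) ^ 2 := by
  have hD' : ∀ v, MemLp (mtD u v) 2 (volume.restrict Ω) := by
    intro v
    have : mtD u v = fun x => ∑ i, v i * mtD u (EuclideanSpace.single i 1) x :=
      funext fun x => mtD_expand u v x
    rw [this]
    exact memLp_finset_sum _ fun i _ => (hD i).const_mul _
  have hH' : ∀ v w, MemLp (mtH u v w) 2 (volume.restrict Ω) := by
    intro v w
    have h1 : MemLp (fun x => ∑ i, v i * ∑ j, w j *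
        mtH u (EuclideanSpace.single i 1) (EuclideanSpace.single j 1) x) 2 (volume.restrict Ω) :=
      memLp_finset_sum _ fun i _ => (memLp_finset_sum _ fun j _ => (hH i j).const_mul _).const_mul _
    refine h1.ae_eq ?_
    filter_upwards [ae_restrict_mem hΩ.measurableSet] with x hx
    rw [mtH_expand1]
    exact Finset.sum_congr rfl fun i _ => by rw [mtH_expand2 hΩ hu hx _ w]
  have hV : ∀ m, IntegrableOn (mtV c u m) Ω := by
    intro m
    refine integrable_finsetSum _ fun l _ => ?_
    exact ((hD' _).integrable_mul (hH' _ _)).sub ((hD' _).integrable_mul (hH' _ _))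
  have hS2 : IntegrableOn (fun x => ∑ m, ∑ l, mtH u (c m) (c l) x ^ 2) Ω :=
    integrable_finsetSum _ fun m _ => integrable_finsetSum _ fun l _ => (hH' _ _).integrable_sq
  have hS1 : IntegrableOn (fun x => (∑ m, mtH u (c m) (c m) x) ^ 2) Ω :=
    (memLp_finset_sum _ fun m _ => hH' (c m) (c m)).integrable_sq
  have hJe : mtJ c u = fun x => (∑ m, mtH u (c m) (c m) x) ^ 2 - ∑ m, ∑ l, mtH u (c m) (c l) x ^ 2 := by
    funext x
    simp only [mtJ, Finset.sum_sub_distrib]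
    rw [sq, Finset.sum_mul_sum]
  have hJ : IntegrableOn (mtJ c u) Ω := by
    rw [hJe]; exact hS1.sub hS2
  have h := mt_stepC c hΩ hcv hb hu htr hV hJ
  rw [hJe, integral_sub hS1 hS2] at h
  have h2 : ν ^ 2 * ∫ x in Ω, ∑ i, ∑ j,
        mtH u (EuclideanSpace.single i 1) (EuclideanSpace.single j 1) x ^ 2 ≤
      ∫ x in Ω, ∑ m, ∑ l, mtH u (c m) (c l) x ^ 2 := by
    rw [← integral_const_mul]
    refine setIntegral_mono_on ?_ hS2 hΩ.measurableSet fun x hx => mt_coer c hΩ hu hν hc hx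
    exact Integrable.const_mul (integrable_finsetSum _ fun i _ =>
      integrable_finsetSum _ fun j _ => (hH i j).integrable_sq) _
  linarith


theorem mt_LA1 {N : ℕ} {B : Fin N → Matrix (Fin N) (Fin N) ℝ} (hBs : ∀ γ, (B γ).IsSymm)
    (horth : ∀ γ δ, γ ≠ δ → ∀ y z : Fin N → ℝ, ∑ α, (B γ).mulVec y α * (B δ).mulVec z α = 0)
    (hpd : (∑ γ, B γ).PosDef) :
    ∃ (ι : Type) (_ : Fintype ι) (γ : ι → Fin N) (b : ι → ℝ) (e : ι → Fin N → ℝ),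
      (∀ p, ∑ α, e p α ^ 2 = 1) ∧ (∀ p, (B (γ p)).mulVec (e p) = b p • e p) ∧
      (∀ p δ, δ ≠ γ p → (B δ).mulVec (e p) = 0) ∧
      (∀ y : Fin N → ℝ, ∑ p, (∑ α, e p α * y α) ^ 2 = ∑ α, y α ^ 2) := by
  classical
  have hB : ∀ γ, (B γ).IsHermitian := fun γ => by
    have := hBs γ
    rw [Matrix.IsHermitian, Matrix.conjTranspose_eq_transpose_of_trivial]; exact this
  have hadj : ∀ γ (y z : Fin N → ℝ), y ⬝ᵥ (B γ).mulVec z = (B γ).mulVec y ⬝ᵥ z := by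
    intro γ y z
    rw [Matrix.dotProduct_mulVec, ← Matrix.mulVec_transpose, hBs γ]
  let ι := {p : Fin N × Fin N // (hB p.1).eigenvalues p.2 ≠ 0}
  let E : ι → EuclideanSpace ℝ (Fin N) := fun p => (hB p.1.1).eigenvectorBasis p.1.2
  let b : ι → ℝ := fun p => (hB p.1.1).eigenvalues p.1.2
  have hb : ∀ p, b p ≠ 0 := fun p => p.2
  have hE : ∀ p : ι, (B p.1.1).mulVec (E p).ofLp = b p • (E p).ofLp := fun p =>
    (hB p.1.1).mulVec_eigenvectorBasis p.1.2
  have horth' : ∀ γ δ, γ ≠ δ → ∀ y z : Fin N → ℝ, (B γ).mulVec y ⬝ᵥ (B δ).mulVec z = 0 := horth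
  have hinner : ∀ x y : EuclideanSpace ℝ (Fin N), inner ℝ x y = x.ofLp ⬝ᵥ y.ofLp := by
    intro x y
    simp [PiLp.inner_apply, dotProduct, mul_comm]
  have hon : Orthonormal ℝ E := by
    rw [orthonormal_iff_ite]
    intro p q
    by_cases h : p.1.1 = q.1.1
    · obtain ⟨⟨γ, k⟩, hp⟩ := p
      obtain ⟨⟨δ, l⟩, hq⟩ := q
      simp only at h
      subst h
      have := orthonormal_iff_ite.1 (hB γ).eigenvectorBasis.orthonormal k l
      have hiff : ((⟨(γ, k), hp⟩ : ι) = ⟨(γ, l), hq⟩) ↔ k = l := by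
        constructor
        · intro h
          exact congrArg (fun p : ι => p.1.2) h
        · rintro rfl
          rfl
      simp only [E, this]
      by_cases hkl : k = l
      · rw [if_pos hkl, if_pos (hiff.2 hkl)]
      · rw [if_neg hkl, if_neg (fun h => hkl (hiff.1 h))]
    · have hpq : p ≠ q := fun h' => h (by rw [h'])
      rw [if_neg hpq, hinner]
      have h1 := horth' _ _ h (E p).ofLp (E q).ofLp
      rw [hE, hE, smul_dotProduct, dotProduct_smul, smul_eq_mul, smul_eq_mul] at h1
      have := hb p
      have := hb q
      simp_all
  have hbot : (Submodule.span ℝ (Set.range E))ᗮ = ⊥ := by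
    rw [eq_bot_iff]
    intro v hv
    have hv1 : ∀ p, (E p).ofLp ⬝ᵥ v.ofLp = 0 := by
      intro p
      rw [← hinner]
      exact (Submodule.mem_orthogonal _ _).1 hv _ (Submodule.subset_span ⟨p, rfl⟩)
    have hBv : ∀ γ, (B γ).mulVec v.ofLp = 0 := by
      intro γ
      have : ∀ k, inner ℝ ((hB γ).eigenvectorBasis k) (WithLp.toLp 2 ((B γ).mulVec v.ofLp)) = 0 := by
        intro k
        rw [hinner]
        simp only []
        rw [hadj, (hB γ).mulVec_eigenvectorBasis, smul_dotProduct]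
        by_cases h : (hB γ).eigenvalues k = 0
        · rw [h, zero_smul]
        · have := hv1 ⟨(γ, k), h⟩
          simp only [E] at this
          rw [this, smul_zero]
      have h2 : (WithLp.toLp 2 ((B γ).mulVec v.ofLp) : EuclideanSpace ℝ (Fin N)) = 0 := by
        have h4 := (hB γ).eigenvectorBasis.sum_sq_norm_inner_right (WithLp.toLp 2 ((B γ).mulVec v.ofLp))
        rw [Finset.sum_eq_zero (fun k _ => by rw [this k]; simp)] at h4
        exact norm_eq_zero.1 (pow_eq_zero_iff two_ne_zero |>.1 h4.symm)
      exact congrArg WithLp.ofLp h2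
    by_contra hne
    have hne' : v.ofLp ≠ 0 := by
      intro h
      apply hne
      rw [Submodule.mem_bot]
      ext i
      simp [h]
    have h3 := hpd.dotProduct_mulVec_pos hne'
    rw [Matrix.sum_mulVec, Finset.sum_eq_zero (fun γ _ => hBv γ)] at h3
    simp at h3
  let OB := OrthonormalBasis.mkOfOrthogonalEqBot hon hbot
  have hOB : ∀ p, OB p = E p := fun p => by simp [OB]
  refine ⟨ι, inferInstance, fun p => p.1.1, b, fun p => (E p).ofLp, ?_, hE, ?_, ?_⟩
  · intro p
    have := hon.1 p
    rw [EuclideanSpace.norm_eq, Real.sqrt_eq_one] at this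
    simpa using this
  · intro p δ hδ
    have h1 : ∀ z, z ⬝ᵥ (B δ).mulVec (E p).ofLp = 0 := by
      intro z
      have h2 := horth' _ _ hδ z (E p).ofLp
      rw [hE, dotProduct_smul, smul_eq_mul] at h2
      rw [hadj]
      exact (mul_eq_zero.1 h2).resolve_left (hb p)
    exact dotProduct_self_eq_zero.1 (h1 _)
  · intro y
    have := OB.sum_sq_norm_inner_right (WithLp.toLp 2 y)
    simp only [hOB, hinner, EuclideanSpace.norm_sq_eq, Real.norm_eq_abs, sq_abs] at this
    exact this


theorem mt_scalarQ {n : ℕ} (Q : Matrix (Fin n) (Fin n) ℝ) (hQ : Q.IsSymm) {Ω : Set (Euc n)}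
    (hΩ : IsOpen Ω) (hcv : Convex ℝ Ω) (hb : Bornology.IsBounded Ω)
    {u : Euc n → ℝ} (hu : ContDiffOn ℝ 2 u Ω)
    (htr : ∀ x ∈ frontier Ω, Tendsto u (𝓝[Ω] x) (𝓝 0))
    (hD : ∀ i, MemLp (mtD u (EuclideanSpace.single i 1)) 2 (volume.restrict Ω))
    (hH : ∀ i j, MemLp (mtH u (EuclideanSpace.single i 1) (EuclideanSpace.single j 1)) 2
      (volume.restrict Ω)) {ν : ℝ} (hν : 0 ≤ ν)
    (hc : ∀ y : Fin n → ℝ, ν * ∑ i, y i ^ 2 ≤ ∑ i, ∑ j, Q i j * y i * y j) :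
    ν ^ 2 * ∫ x in Ω, ∑ i, ∑ j,
        mtH u (EuclideanSpace.single i 1) (EuclideanSpace.single j 1) x ^ 2 ≤
      ∫ x in Ω, (∑ i, ∑ j, Q i j *
        mtH u (EuclideanSpace.single i 1) (EuclideanSpace.single j 1) x) ^ 2 := by
  have hpsd : Q.PosSemidef := by
    refine Matrix.PosSemidef.of_dotProduct_mulVec_nonneg ?_ fun y => ?_
    · rw [Matrix.IsHermitian, Matrix.conjTranspose_eq_transpose_of_trivial]; exact hQ
    · have : star y ⬝ᵥ Q.mulVec y = ∑ i, ∑ j, Q i j * y i * y j := by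
        simp only [dotProduct, Matrix.mulVec, Finset.mul_sum, star_trivial]
        exact Finset.sum_congr rfl fun i _ => Finset.sum_congr rfl fun j _ => by ring
      rw [this]
      exact (mul_nonneg hν (Finset.sum_nonneg fun i _ => sq_nonneg _)).trans (hc y)
  obtain ⟨C, hC⟩ := mt_factor hpsd
  have hQC : ∀ i j, Q i j = ∑ k, C k i * C k j := by
    intro i j
    rw [hC]
    simp [Matrix.mul_apply]
  have h := mt_scalar (fun k => WithLp.toLp 2 (C k)) hΩ hcv hb hu htr hD hH hν (by
    intro y
    refine (hc y).trans_eq ?_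
    simp only [hQC, sq, Finset.sum_mul_sum]
    symm
    rw [Finset.sum_comm]
    refine Finset.sum_congr rfl fun i _ => ?_
    rw [Finset.sum_comm]
    refine Finset.sum_congr rfl fun j _ => ?_
    rw [Finset.sum_mul, Finset.sum_mul]
    exact Finset.sum_congr rfl fun k _ => by ring)
  refine h.trans_eq (setIntegral_congr_fun hΩ.measurableSet fun x hx => ?_)
  have : ∑ k, mtH u (WithLp.toLp 2 (C k)) (WithLp.toLp 2 (C k)) x = ∑ i, ∑ j, Q i j *
        mtH u (EuclideanSpace.single i 1) (EuclideanSpace.single j 1) x := by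
    have e1 : ∀ k, mtH u (WithLp.toLp 2 (C k)) (WithLp.toLp 2 (C k)) x = ∑ i, ∑ j, C k i * (C k j *
        mtH u (EuclideanSpace.single i 1) (EuclideanSpace.single j 1) x) := by
      intro k
      rw [mtH_expand1]
      refine Finset.sum_congr rfl fun i _ => ?_
      rw [mtH_expand2 hΩ hu hx, Finset.mul_sum]
    simp only [e1]
    rw [Finset.sum_comm]
    refine Finset.sum_congr rfl fun i _ => ?_
    rw [Finset.sum_comm]
    refine Finset.sum_congr rfl fun j _ => ?_
    rw [hQC, Finset.sum_mul]
    exact Finset.sum_congr rfl fun k _ => by ring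
  simp only [this]

theorem mt_AC {n N : ℕ} {A : Fin N → Fin n → Fin N → Fin n → ℝ}
    {B : Fin N → Matrix (Fin N) (Fin N) ℝ} {M : Fin N → Matrix (Fin n) (Fin n) ℝ}
    (hBs : ∀ γ, (B γ).IsSymm) (hA : ∀ α i β j, A α i β j = ∑ γ, B γ α β * M γ i j)
    {g : Fin N} {b : ℝ} {η : Fin N → ℝ} (h1 : (B g).mulVec η = b • η)
    (h2 : ∀ δ, δ ≠ g → (B δ).mulVec η = 0) (X : Fin N → Fin n → Fin n → ℝ) :
    ∑ α, η α * AC A X α = ∑ i, ∑ j, (b * M g i j) * ∑ β, η β * X β i j := by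
  have hs : ∀ γ β, ∑ α, B γ α β * η α = (B γ).mulVec η β := by
    intro γ β
    simp only [Matrix.mulVec, dotProduct]
    exact Finset.sum_congr rfl fun α _ => by rw [(hBs γ).apply]
  have key : ∀ i β j, ∑ α, η α * (A α i β j * X β i j) = b * M g i j * (η β * X β i j) := by
    intro i β j
    calc ∑ α, η α * (A α i β j * X β i j)
        = ∑ α, ∑ γ, (M γ i j * X β i j) * (B γ α β * η α) := by
          refine Finset.sum_congr rfl fun α _ => ?_
          rw [hA, Finset.sum_mul, Finset.mul_sum]
          exact Finset.sum_congr rfl fun γ _ => by ring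
      _ = ∑ γ, (M γ i j * X β i j) * (B γ).mulVec η β := by
          rw [Finset.sum_comm]
          exact Finset.sum_congr rfl fun γ _ => by rw [← Finset.mul_sum, hs]
      _ = (M g i j * X β i j) * (B g).mulVec η β := by
          refine Finset.sum_eq_single g (fun δ _ hδ => ?_) (by simp)
          rw [h2 δ hδ]; simp
      _ = _ := by rw [h1]; simp; ring
  unfold AC
  simp only [Finset.mul_sum]
  rw [Finset.sum_comm]
  refine Finset.sum_congr rfl fun i _ => ?_
  rw [Finset.sum_comm]
  rw [Finset.sum_comm (s := (Finset.univ : Finset (Fin n)))]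
  refine Finset.sum_congr rfl fun β _ => ?_
  rw [Finset.sum_comm]
  exact Finset.sum_congr rfl fun j _ => key i β j

theorem mt_QF {n N : ℕ} (A : Fin N → Fin n → Fin N → Fin n → ℝ) (η : Fin N → ℝ) (a : Fin n → ℝ) :
    QF A η a = ∑ α, η α * AC A (fun β i j => η β * a i * a j) α := by
  unfold QF AC
  simp only [Finset.mul_sum]
  refine Finset.sum_congr rfl fun α _ => Finset.sum_congr rfl fun i _ =>
    Finset.sum_congr rfl fun β _ => Finset.sum_congr rfl fun j _ => by ring

theorem mt_nu {n N : ℕ} {A : Fin N → Fin n → Fin N → Fin n → ℝ} (hpos : RankOnePos A)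
    {η : Fin N → ℝ} (hη : vsq η = 1) (a : Fin n → ℝ) : nuA A * vsq a ≤ QF A η a := by
  obtain ⟨ν, hν, hq⟩ := hpos
  by_cases ha : vsq a = 0
  · rw [ha, mul_zero]
    have := hq η a
    rwa [ha, mul_zero] at this
  have ha' : 0 < vsq a := lt_of_le_of_ne (Finset.sum_nonneg fun i _ => sq_nonneg _) (Ne.symm ha)
  set t := Real.sqrt (vsq a) with ht
  have htp : 0 < t := Real.sqrt_pos.2 ha'
  have ht2 : t ^ 2 = vsq a := Real.sq_sqrt ha'.le
  have h1 : vsq (fun i => t⁻¹ * a i) = 1 := by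
    have : vsq (fun i => t⁻¹ * a i) = (t⁻¹) ^ 2 * vsq a := by
      simp only [vsq, mul_pow, Finset.mul_sum]
    rw [this, ← ht2]
    field_simp
  have h2 : QF A η (fun i => t⁻¹ * a i) = (vsq a)⁻¹ * QF A η a := by
    rw [← ht2]
    simp only [QF, Finset.mul_sum]
    refine Finset.sum_congr rfl fun α _ => Finset.sum_congr rfl fun i _ =>
      Finset.sum_congr rfl fun β _ => Finset.sum_congr rfl fun j _ => by field_simp
  have h3 : nuA A ≤ (vsq a)⁻¹ * QF A η a := by
    refine csInf_le ⟨ν, ?_⟩ ⟨η, _, hη, h1, h2.symm⟩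
    rintro v ⟨η', a', hη', ha2, rfl⟩
    have := hq η' a'
    rw [hη', ha2] at this
    linarith
  calc nuA A * vsq a ≤ (vsq a)⁻¹ * QF A η a * vsq a := mul_le_mul_of_nonneg_right h3 ha'.le
    _ = QF A η a := by field_simp

theorem mt_nu_pos {n N : ℕ} {A : Fin (N+1) → Fin (n+1) → Fin (N+1) → Fin (n+1) → ℝ}
    (hpos : RankOnePos A) : 0 < nuA A := by
  obtain ⟨ν, hν, hq⟩ := hpos
  refine lt_of_lt_of_le hν (le_csInf ⟨_, Pi.single 0 1, Pi.single 0 1, ?_, ?_, rfl⟩ ?_)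
  · simp [vsq, Pi.single_apply]
  · simp [vsq, Pi.single_apply]
  rintro v ⟨η', a', hη', ha2, rfl⟩
  have := hq η' a'
  rw [hη', ha2] at this
  linarith

theorem mt_main {n N : ℕ}
    (A : Fin N → Fin n → Fin N → Fin n → ℝ)
    (hpos : RankOnePos A) (hSH : SH A) (hν : 0 ≤ nuA A)
    (Ω : Set (Euc n)) (hΩ : IsOpen Ω) (hcv : Convex ℝ Ω)
    (hbd : Bornology.IsBounded Ω)
    (u : Euc n → Fin N → ℝ) (hu : IsH2H10 Ω u) :
    nuA A ^ 2 * ∫ x in Ω, tsq (Hess u x) ≤ ∫ x in Ω, vsq (AC A (Hess u x)) := by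
  obtain ⟨B, M, hBs, hMs, hA, horth, hpd, -, -⟩ := hSH
  obtain ⟨ι, hι, γ, b, e, he1, he2, he3, he4⟩ := mt_LA1 hBs horth hpd
  have hC := hu.contDiffOn
  have hHα : ∀ α i j, MemLp (mtH (fun y => u y α) (EuclideanSpace.single i 1)
      (EuclideanSpace.single j 1)) 2 (volume.restrict Ω) := by
    intro α i j
    have hm := (mtH_contOn hΩ (hC α) (EuclideanSpace.single i 1)
      (EuclideanSpace.single j 1)).aestronglyMeasurable (μ := volume) hΩ.measurableSet
    rw [memLp_two_iff_integrable_sq hm]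
    refine Integrable.mono' hu.hess_memL2 (hm.pow 2) (Eventually.of_forall fun x => ?_)
    rw [Real.norm_eq_abs, abs_of_nonneg (sq_nonneg _)]
    have h1 := Finset.single_le_sum (f := fun α => ∑ i, ∑ j, (Hess u x α i j) ^ 2)
      (fun α _ => by positivity) (Finset.mem_univ α)
    have h2 := Finset.single_le_sum (f := fun i => ∑ j, (Hess u x α i j) ^ 2)
      (fun i _ => by positivity) (Finset.mem_univ i)
    have h3 := Finset.single_le_sum (f := fun j => (Hess u x α i j) ^ 2)
      (fun j _ => by positivity) (Finset.mem_univ j)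
    exact h3.trans (h2.trans h1)
  have hDα : ∀ α i, MemLp (mtD (fun y => u y α) (EuclideanSpace.single i 1)) 2
      (volume.restrict Ω) := by
    intro α i
    have hm := (mtD_contOn hΩ (hC α) (EuclideanSpace.single i 1)).aestronglyMeasurable
      (μ := volume) hΩ.measurableSet
    rw [memLp_two_iff_integrable_sq hm]
    refine Integrable.mono' hu.grad_memL2 (hm.pow 2) (Eventually.of_forall fun x => ?_)
    rw [Real.norm_eq_abs, abs_of_nonneg (sq_nonneg _)]
    have h1 := Finset.single_le_sum (f := fun α => ∑ i, (pder (fun y => u y α) i x) ^ 2)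
      (fun α _ => by positivity) (Finset.mem_univ α)
    have h2 := Finset.single_le_sum (f := fun i => (pder (fun y => u y α) i x) ^ 2)
      (fun i _ => by positivity) (Finset.mem_univ i)
    exact h2.trans h1
  set f : ι → Euc n → ℝ := fun p y => ∑ α, e p α * u y α with hf
  have hfC : ∀ p, ContDiffOn ℝ 2 (f p) Ω := fun p =>
    ContDiffOn.sum fun α _ => contDiffOn_const.mul (hC α)
  have hfH : ∀ p, ∀ x ∈ Ω, ∀ v w, mtH (f p) v w x = ∑ α, e p α * mtH (fun y => u y α) v w x :=
    fun p x hx v w => mtH_lin hΩ hC (e p) hx v w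
  have hfHL : ∀ p i j, MemLp (mtH (f p) (EuclideanSpace.single i 1)
      (EuclideanSpace.single j 1)) 2 (volume.restrict Ω) := by
    intro p i j
    have h1 : MemLp (fun x => ∑ α, e p α * mtH (fun y => u y α) (EuclideanSpace.single i 1)
        (EuclideanSpace.single j 1) x) 2 (volume.restrict Ω) :=
      memLp_finsetSum _ fun α _ => (hHα α i j).const_mul (e p α)
    refine h1.ae_eq ?_
    filter_upwards [ae_restrict_mem hΩ.measurableSet] with x hx
    rw [hfH p x hx]
  have hfDL : ∀ p i, MemLp (mtD (f p) (EuclideanSpace.single i 1)) 2 (volume.restrict Ω) := by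
    intro p i
    have h1 : MemLp (fun x => ∑ α, e p α * mtD (fun y => u y α) (EuclideanSpace.single i 1)
        x) 2 (volume.restrict Ω) :=
      memLp_finsetSum _ fun α _ => (hDα α i).const_mul (e p α)
    refine h1.ae_eq ?_
    filter_upwards [ae_restrict_mem hΩ.measurableSet] with x hx
    exact (mtD_lin hΩ hC (e p) hx _).symm
  have hftr : ∀ p, ∀ x ∈ frontier Ω, Tendsto (f p) (𝓝[Ω] x) (𝓝 0) := by
    intro p x hx
    have h1 := tendsto_pi_nhds.1 (hu.zero_trace x hx)
    have h2 : Tendsto (f p) (𝓝[Ω] x) (𝓝 (∑ α, e p α * 0)) :=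
      tendsto_finsetSum _ fun α _ => (h1 α).const_mul _
    simpa using h2
  have hp : ∀ p, nuA A ^ 2 * ∫ x in Ω, ∑ i, ∑ j,
        mtH (f p) (EuclideanSpace.single i 1) (EuclideanSpace.single j 1) x ^ 2 ≤
      ∫ x in Ω, (∑ i, ∑ j, (b p • M (γ p)) i j *
        mtH (f p) (EuclideanSpace.single i 1) (EuclideanSpace.single j 1) x) ^ 2 := by
    intro p
    refine mt_scalarQ (b p • M (γ p)) ((hMs _).smul _) hΩ hcv hbd (hfC p) (hftr p) (hfDL p)
      (hfHL p) hν fun a => ?_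
    refine (mt_nu hpos (he1 p) a).trans_eq ?_
    rw [mt_QF, mt_AC hBs hA (he2 p) (he3 p)]
    refine Finset.sum_congr rfl fun i _ => Finset.sum_congr rfl fun j _ => ?_
    have : ∑ β, e p β * (e p β * a i * a j) = a i * a j := by
      calc ∑ β, e p β * (e p β * a i * a j) = (∑ β, e p β ^ 2) * (a i * a j) := by
            rw [Finset.sum_mul]
            exact Finset.sum_congr rfl fun β _ => by ring
        _ = _ := by rw [he1, one_mul]
    rw [this]
    simp only [Matrix.smul_apply, smul_eq_mul]
    ring
  have hL : ∫ x in Ω, tsq (Hess u x) = ∑ p, ∫ x in Ω, ∑ i, ∑ j,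
        mtH (f p) (EuclideanSpace.single i 1) (EuclideanSpace.single j 1) x ^ 2 := by
    rw [← integral_finsetSum _ fun p _ => integrable_finsetSum _ fun i _ =>
      integrable_finsetSum _ fun j _ => (hfHL p i j).integrable_sq]
    refine setIntegral_congr_fun hΩ.measurableSet fun x hx => ?_
    simp only [hfH _ x hx, tsq]
    rw [Finset.sum_comm, Finset.sum_comm (s := (Finset.univ : Finset ι))]
    refine Finset.sum_congr rfl fun i _ => ?_
    rw [Finset.sum_comm, Finset.sum_comm (s := (Finset.univ : Finset ι))]
    refine Finset.sum_congr rfl fun j _ => ?_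
    exact (he4 fun α => Hess u x α i j).symm
  have hR : ∫ x in Ω, vsq (AC A (Hess u x)) = ∑ p, ∫ x in Ω, (∑ i, ∑ j, (b p • M (γ p)) i j *
        mtH (f p) (EuclideanSpace.single i 1) (EuclideanSpace.single j 1) x) ^ 2 := by
    have hint : ∀ p, IntegrableOn (fun x => (∑ i, ∑ j, (b p • M (γ p)) i j *
        mtH (f p) (EuclideanSpace.single i 1) (EuclideanSpace.single j 1) x) ^ 2) Ω := by
      intro p
      have h1 : MemLp (fun x => ∑ i, ∑ j, (b p • M (γ p)) i j *
          mtH (f p) (EuclideanSpace.single i 1) (EuclideanSpace.single j 1) x) 2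
          (volume.restrict Ω) :=
        memLp_finsetSum _ fun i _ => memLp_finsetSum _ fun j _ =>
          (hfHL p i j).const_mul ((b p • M (γ p)) i j)
      exact h1.integrable_sq
    rw [← integral_finsetSum _ fun p _ => hint p]
    refine setIntegral_congr_fun hΩ.measurableSet fun x hx => ?_
    simp only [hfH _ x hx]
    unfold vsq
    rw [← he4]
    refine Finset.sum_congr rfl fun p _ => ?_
    rw [mt_AC hBs hA (he2 p) (he3 p)]
    rfl
  rw [hL, hR, Finset.mul_sum]
  exact Finset.sum_le_sum fun p _ => hp p

open MeasureTheory

/-- The generalised Miranda–Talenti inequality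
`‖D²u‖_{L²(Ω)} ≤ (1/ν(𝐀)) ‖𝐀:D²u‖_{L²(Ω)}` for every `u ∈ (H² ∩ H¹₀)(Ω)^N`,
where `𝐀 ∈ ℝ^{Nn×Nn}_s` is rank-one positive and satisfies (SH), and
`Ω ⊆ ℝⁿ` is open, convex and bounded with `C²` boundary. -/
theorem generalised_miranda_talenti
    {n N : ℕ}
    (A : Fin N → Fin n → Fin N → Fin n → ℝ) (hsym : SymT A)
    (hpos : RankOnePos A) (hSH : SH A)
    (Ω : Set (Euc n)) (hopen : IsOpen Ω) (hconv : Convex ℝ Ω)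
    (hbdd : Bornology.IsBounded Ω) (hC2 : IsC2Domain Ω)
    (u : Euc n → Fin N → ℝ) (hu : IsH2H10 Ω u) :
    L2T Ω (fun x => Hess u x) ≤ (1 / nuA A) * L2V Ω (fun x => AC A (Hess u x)) := by
  have hnn : 0 ≤ nuA A := by
    obtain ⟨ν, hν, hq⟩ := hpos
    refine Real.sInf_nonneg ?_
    rintro v ⟨η', a', hη', ha2, rfl⟩
    have := hq η' a'
    rw [hη', ha2] at this
    linarith
  have hrhs : 0 ≤ (1 / nuA A) * L2V Ω (fun x => AC A (Hess u x)) :=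
    mul_nonneg (by positivity) (Real.sqrt_nonneg _)
  rcases N with _ | N
  · have : L2T Ω (fun x => Hess u x) = 0 := by simp [L2T, tsq]
    rw [this]; exact hrhs
  rcases n with _ | n
  · have : L2T Ω (fun x => Hess u x) = 0 := by simp [L2T, tsq]
    rw [this]; exact hrhs
  have hp := mt_nu_pos hpos
  have h := mt_main A hpos hSH hnn Ω hopen hconv hbdd u hu
  unfold L2T L2V
  rw [one_div, ← div_eq_inv_mul, le_div_iff₀ hp]
  refine Real.le_sqrt_of_sq_le ?_
  rw [mul_pow, Real.sq_sqrt (integral_nonneg fun x => ?_)]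
  · linarith
  · unfold tsq
    positivity
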